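/- arXiv:1407.0559 — 2 statements merged into one kernel-verified Lean document; each statement's English description precedes it below -/
import Mathlib

section
/- Let R be a commutative Noetherian ring, a an ideal of R, M a finitely generated R-module, n a non-negative integer, and set t = f_a^n(M). Then for every submodule N of ⊕_{i=0}^{t-1} H^i_a(M), the set (Ass_R(⊕_{i=0}^{t-1} H^i_a(M) / N))_{≥n} is finite. -/
open CategoryTheory

noncomputable section

/-- An `R`-module `M` is *in dimension `< n`* if there exists a finitely generated
submodule `N ⊆ M` such that `dim Supp (M/N) < n`. -/
def InDimLT (R : Type) [CommRing R] (M : Type) [AddCommGroup M] [Module R M] (n : ℕ) : Prop :=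
  ∃ N : Submodule R M, N.FG ∧ Order.krullDim (Module.support R (M ⧸ N)) < (n : WithBot ℕ∞)

/-- The `i`-th local cohomology module of `M` with support in the ideal `a`. -/
def locCoh (R : Type) [CommRing R] (a : Ideal R) (i : ℕ)
    (M : Type) [AddCommGroup M] [Module R M] : ModuleCat R :=
  (localCohomology a i).obj (ModuleCat.of R M)

/-- The finiteness dimension `f_a(M)`:  the least `i` such that `H^i_a(M)` is not
finitely generated (`∞` if there is no such `i`). -/
def finDim (R : Type) [CommRing R] (a : Ideal R)
    (M : Type) [AddCommGroup M] [Module R M] : ℕ∞ :=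
  sInf (Nat.cast '' {i : ℕ | ¬ Module.Finite R ↥(locCoh R a i M)})

/-- The `n`-th finiteness dimension `f_a^n(M)`. -/
def finDimN (R : Type) [CommRing R] (a : Ideal R) (n : ℕ)
    (M : Type) [AddCommGroup M] [Module R M] : ℕ∞ :=
  sInf {d : ℕ∞ | ∃ p : PrimeSpectrum R,
    p ∈ Module.support R (M ⧸ (a • ⊤ : Submodule R M)) ∧
    (n : WithBot ℕ∞) ≤ ringKrullDim (R ⧸ p.asIdeal) ∧
    d = finDim (Localization.AtPrime p.asIdeal)
      (a.map (algebraMap R (Localization.AtPrime p.asIdeal)))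
      (LocalizedModule p.asIdeal.primeCompl M)}

/-- `h_a^n(M)`: the least `i` such that `H^i_a(M)` is not in dimension `< n`. -/
def hDimN (R : Type) [CommRing R] (a : Ideal R) (n : ℕ)
    (M : Type) [AddCommGroup M] [Module R M] : ℕ∞ :=
  sInf (Nat.cast '' {i : ℕ | ¬ InDimLT R ↥(locCoh R a i M) n})

open DirectSum

universe u

section LocalCohomologyFiniteness

open Abelian

section Model

variable {R : Type u} [CommRing R] (a : Ideal R)

/-- The projection `R ⧸ a ^ l ⟶ R ⧸ a ^ k` for `k ≤ l`. -/
def quotPowMap {k l : ℕ} (h : k ≤ l) :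
    ModuleCat.of R (R ⧸ a ^ l) ⟶ ModuleCat.of R (R ⧸ a ^ k) :=
  ModuleCat.ofHom (Submodule.mapQ _ _ LinearMap.id (Ideal.pow_le_pow_right h))

lemma quotPowMap_self (k : ℕ) : quotPowMap a (le_refl k) = 𝟙 _ := by
  refine ModuleCat.hom_ext (LinearMap.ext fun x ↦ ?_)
  obtain ⟨x, rfl⟩ := Submodule.Quotient.mk_surjective _ x
  rfl

lemma quotPowMap_comp {k l m : ℕ} (h : k ≤ l) (h' : l ≤ m) :
    quotPowMap a h' ≫ quotPowMap a h = quotPowMap a (h.trans h') := by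
  refine ModuleCat.hom_ext (LinearMap.ext fun x ↦ ?_)
  obtain ⟨x, rfl⟩ := Submodule.Quotient.mk_surjective _ x
  rfl

/-- Restriction of extension classes along `R ⧸ a ^ l ⟶ R ⧸ a ^ k`. -/
def extQuotPowMap (i : ℕ) (N : ModuleCat.{u} R) (k l : ℕ) (h : k ≤ l) :
    Abelian.Ext (ModuleCat.of R (R ⧸ a ^ k)) N i →ₗ[R]
      Abelian.Ext (ModuleCat.of R (R ⧸ a ^ l)) N i :=
  Ext.bilinearCompOfLinear R _ _ _ 0 i i (zero_add i) (Ext.mk₀ (quotPowMap a h))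

@[simp]
lemma extQuotPowMap_apply (i : ℕ) (N : ModuleCat.{u} R) (k l : ℕ) (h : k ≤ l)
    (x : Abelian.Ext (ModuleCat.of R (R ⧸ a ^ k)) N i) :
    extQuotPowMap a i N k l h x = (Ext.mk₀ (quotPowMap a h)).comp x (zero_add i) :=
  rfl

instance (i : ℕ) (N : ModuleCat.{u} R) :
    DirectedSystem (fun k : ℕ ↦ Abelian.Ext (ModuleCat.of R (R ⧸ a ^ k)) N i)
      (extQuotPowMap a i N · · ·) where
  map_self k x := by simp [quotPowMap_self]
  map_map k l m h h' x := by simp [quotPowMap_comp]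

/-- Local cohomology as the direct limit of `Ext` modules in the sense of the derived category. -/
abbrev LocCohModel (i : ℕ) (N : ModuleCat.{u} R) : Type u :=
  Module.DirectLimit (fun k : ℕ ↦ Abelian.Ext (ModuleCat.of R (R ⧸ a ^ k)) N i)
    (extQuotPowMap a i N)

namespace LocCohModel

/-- The canonical map from `Ext` modules to local cohomology. -/
abbrev of (i : ℕ) (N : ModuleCat.{u} R) (k : ℕ) :
    Abelian.Ext (ModuleCat.of R (R ⧸ a ^ k)) N i →ₗ[R] LocCohModel a i N :=
  Module.DirectLimit.of R ℕ _ (extQuotPowMap a i N) k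

/-- Composition with an extension class, on local cohomology. -/
def comp {N N' : ModuleCat.{u} R} {d : ℕ} (e : Abelian.Ext N N' d) (i j : ℕ) (h : i + d = j) :
    LocCohModel a i N →ₗ[R] LocCohModel a j N' :=
  Module.DirectLimit.map
    (fun _ ↦ (Ext.bilinearCompOfLinear R _ _ _ i d j h).flip e) fun k l hkl ↦ by
      ext x
      simpa using Ext.comp_assoc _ x e _ h (by omega)

@[simp]
lemma comp_of {N N' : ModuleCat.{u} R} {d : ℕ} (e : Abelian.Ext N N' d) (i j : ℕ) (h : i + d = j)
    (k : ℕ) (x : Abelian.Ext (ModuleCat.of R (R ⧸ a ^ k)) N i) :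
    comp a e i j h (of a i N k x) = of a j N' k (x.comp e h) := by
  simp [comp]

lemma exact_comp {N N' N'' : ModuleCat.{u} R} {d d' : ℕ} (e : Abelian.Ext N N' d)
    (e' : Abelian.Ext N' N'' d') (i j j' : ℕ) (h : i + d = j) (h' : j + d' = j')
    (H₀ : e.comp e' rfl = 0)
    (H : ∀ (X : ModuleCat.{u} R) (x : Abelian.Ext X N' j), x.comp e' h' = 0 →
      ∃ y : Abelian.Ext X N i, y.comp e h = x) :
    Function.Exact (comp a e i j h) (comp a e' j j' h') := by
  intro x
  constructor
  · obtain ⟨k, x, rfl⟩ := Module.DirectLimit.exists_of x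
    intro hx
    rw [comp_of] at hx
    obtain ⟨l, hkl, hl⟩ := Module.DirectLimit.of.zero_exact hx
    obtain ⟨y, hy⟩ := H _ (extQuotPowMap a j N' k l hkl x) (by
      rw [extQuotPowMap_apply] at hl ⊢
      rwa [Ext.comp_assoc _ _ _ _ _ (by omega)])
    refine ⟨of a i N l y, ?_⟩
    rw [comp_of, hy]
    exact Module.DirectLimit.of_f
  · rintro ⟨y, rfl⟩
    obtain ⟨k, y, rfl⟩ := Module.DirectLimit.exists_of y
    rw [comp_of, comp_of, Ext.comp_assoc _ _ _ _ rfl (by omega), H₀]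
    simp

/-- Functoriality of local cohomology. -/
abbrev map {N N' : ModuleCat.{u} R} (f : N ⟶ N') (i : ℕ) :
    LocCohModel a i N →ₗ[R] LocCohModel a i N' :=
  comp a (Ext.mk₀ f) i i (add_zero i)

lemma map_smul_id (N : ModuleCat.{u} R) (r : R) (i : ℕ) (x : LocCohModel a i N) :
    map a (r • 𝟙 N) i x = r • x := by
  obtain ⟨k, x, rfl⟩ := Module.DirectLimit.exists_of x
  rw [comp_of, Ext.mk₀_smul, Ext.comp_smul, Ext.comp_mk₀_id, map_smul]

lemma exact_map_map {S : ShortComplex (ModuleCat.{u} R)} (hS : S.ShortExact) (i : ℕ) :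
    Function.Exact (map a S.f i) (map a S.g i) :=
  exact_comp a _ _ _ _ _ _ _ (by simp) fun X x hx ↦ Ext.covariant_sequence_exact₂ X hS x hx

variable {S : ShortComplex (ModuleCat.{u} R)} (hS : S.ShortExact)

/-- The connecting map of the long exact sequence. -/
abbrev δ (i : ℕ) : LocCohModel a i S.X₃ →ₗ[R] LocCohModel a (i + 1) S.X₁ :=
  comp a hS.extClass i (i + 1) rfl

lemma exact_map_δ (i : ℕ) : Function.Exact (map a S.g i) (δ a hS i) :=
  exact_comp a _ _ _ _ _ _ _ (by simp) fun X x hx ↦ Ext.covariant_sequence_exact₃ X hS x rfl hx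

lemma exact_δ_map (i : ℕ) : Function.Exact (δ a hS i) (map a S.f (i + 1)) :=
  exact_comp a _ _ _ _ _ _ _ (by simp) fun X x hx ↦ Ext.covariant_sequence_exact₁ X hS x hx rfl

lemma subsingleton_of_injective (I : ModuleCat.{u} R) [Injective I] (i : ℕ) :
    Subsingleton (LocCohModel a (i + 1) I) := by
  refine subsingleton_of_forall_eq 0 fun x ↦ ?_
  obtain ⟨k, x, rfl⟩ := Module.DirectLimit.exists_of x
  rw [Ext.eq_zero_of_injective x, map_zero]

lemma exists_pow_smul_eq_zero (i : ℕ) (N : ModuleCat.{u} R) (x : LocCohModel a i N) :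
    ∃ k : ℕ, ∀ r ∈ a ^ k, r • x = 0 := by
  obtain ⟨k, x, rfl⟩ := Module.DirectLimit.exists_of x
  refine ⟨k, fun r hr ↦ ?_⟩
  have h : r • 𝟙 (ModuleCat.of R (R ⧸ a ^ k)) = 0 := by
    refine ModuleCat.hom_ext (LinearMap.ext fun y ↦ ?_)
    obtain ⟨y, rfl⟩ := Submodule.Quotient.mk_surjective _ y
    exact (Submodule.Quotient.mk_eq_zero _).2 (Ideal.mul_mem_right _ _ hr)
  rw [← map_smul, ← Ext.mk₀_id_comp (r • x), Ext.comp_smul, ← Ext.smul_comp, ← Ext.mk₀_smul, h]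
  simp

end LocCohModel

end Model

section Comparison

open Opposite HomologicalComplex

universe w v u'

variable (R : Type*) [CommRing R] {C : Type u'} [Category.{v} C] [Abelian C] [Linear R C]

namespace CategoryTheory.ProjectiveResolution

variable {X : C} (P : ProjectiveResolution X) (Y : C) (n : ℕ)

/-- The complex of morphisms from a projective resolution, in the opposite category. -/
abbrev homComplexOp : ChainComplex (ModuleCat.{v} R)ᵒᵖ ℕ :=
  (((linearYoneda R C).obj Y).rightOp.mapHomologicalComplex _).obj P.complex

/-- The module of `n`-cocycles of the complex of morphisms from a projective resolution. -/
abbrev cocycles : ModuleCat.{v} R := ((P.homComplexOp R Y).opcycles n).unop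

/-- The morphism underlying a cocycle. -/
def cocyclesι : P.cocycles R Y n →ₗ[R] (P.complex.X n ⟶ Y) :=
  ((P.homComplexOp R Y).pOpcycles n).unop.hom

lemma cocyclesι_injective : Function.Injective (P.cocyclesι R Y n) :=
  (ModuleCat.mono_iff_injective ((P.homComplexOp R Y).pOpcycles n).unop).1 inferInstance

lemma d_comp_cocyclesι (m : ℕ) (z : P.cocycles R Y n) :
    P.complex.d m n ≫ P.cocyclesι R Y n z = 0 := by
  have h := congr_arg Quiver.Hom.unop ((P.homComplexOp R Y).d_pOpcycles m n)
  exact LinearMap.congr_fun (congr_arg ModuleCat.Hom.hom h) z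

lemma exists_cocyclesι_eq (f : P.complex.X n ⟶ Y) (hf : P.complex.d (n + 1) n ≫ f = 0) :
    ∃ z, P.cocyclesι R Y n z = f := by
  have h := (ShortComplex.exact_of_g_is_cokernel
    (ShortComplex.mk ((P.homComplexOp R Y).d (n + 1) n) ((P.homComplexOp R Y).pOpcycles n)
      ((P.homComplexOp R Y).d_pOpcycles (n + 1) n))
    ((P.homComplexOp R Y).opcyclesIsCokernel (n + 1) n (by simp))).unop
  exact (ShortComplex.moduleCat_exact_iff _).1 h f hf

/-- The class of a cocycle. -/
def cocyclesπ : P.cocycles R Y n →ₗ[R] ((P.homComplexOp R Y).homology n).unop :=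
  ((P.homComplexOp R Y).homologyι n).unop.hom

lemma cocyclesπ_surjective : Function.Surjective (P.cocyclesπ R Y n) :=
  (ModuleCat.epi_iff_surjective ((P.homComplexOp R Y).homologyι n).unop).1 inferInstance

lemma cocyclesπ_eq_zero_iff (z : P.cocycles R Y n) :
    P.cocyclesπ R Y n z = 0 ↔ ∃ g : P.complex.X ((ComplexShape.down ℕ).next n) ⟶ Y,
      P.complex.d n _ ≫ g = P.cocyclesι R Y n z := by
  have h := (ShortComplex.exact_of_f_is_kernel
    (ShortComplex.mk ((P.homComplexOp R Y).homologyι n) ((P.homComplexOp R Y).fromOpcycles n _)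
      (by simp)) ((P.homComplexOp R Y).homologyIsKernel n _ rfl)).unop
  rw [ShortComplex.moduleCat_exact_iff] at h
  have hc (g : P.complex.X ((ComplexShape.down ℕ).next n) ⟶ Y) :
      P.cocyclesι R Y n (((P.homComplexOp R Y).fromOpcycles n _).unop.hom g) =
        P.complex.d n _ ≫ g := by
    have h := congr_arg Quiver.Hom.unop ((P.homComplexOp R Y).p_fromOpcycles n
      ((ComplexShape.down ℕ).next n))
    exact LinearMap.congr_fun (congr_arg ModuleCat.Hom.hom h) g
  constructor
  · intro hz
    obtain ⟨g, hg⟩ := h z hz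
    exact ⟨g, (hc g).symm.trans (congr_arg _ hg)⟩
  · rintro ⟨g, hg⟩
    rw [← hc g] at hg
    rw [← P.cocyclesι_injective R Y n hg]
    have h := congr_arg Quiver.Hom.unop ((P.homComplexOp R Y).homologyι_comp_fromOpcycles n
      ((ComplexShape.down ℕ).next n))
    exact LinearMap.congr_fun (congr_arg ModuleCat.Hom.hom h) g

variable [HasExt.{w} C]

lemma extMk_zero_eq_zero {Y : C} (f : P.complex.X 0 ⟶ Y) (m : ℕ) (hm : 0 + 1 = m)
    (hf : P.complex.d m 0 ≫ f = 0) (h : P.extMk f m hm hf = 0) : f = 0 := by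
  rw [← P.extEquivCohomologyClass.apply_eq_iff_eq,
    extEquivCohomologyClass_extMk, extEquivCohomologyClass_zero,
    CochainComplex.HomComplex.CohomologyClass.mk_eq_zero_iff,
    CochainComplex.HomComplex.Cocycle.toSingleMk_mem_coboundaries_iff _ _ _ _ _ 1 (by simp)] at h
  obtain ⟨g, hg⟩ := h
  have h0 : P.cochainComplex.d (-0) 1 = 0 :=
    (P.cochainComplex.isZero_of_isStrictlyLE 0 1).eq_of_tgt _ _
  have hg' : (P.cochainComplexXIso (-(0 : ℕ)) 0 rfl).hom ≫ f = 0 :=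
    hg.symm.trans ((congr_arg (· ≫ g) h0).trans Limits.zero_comp)
  exact (cancel_epi _).1 (hg'.trans Limits.comp_zero.symm)

lemma smul_extMk {Y : C} {n : ℕ} (f : P.complex.X n ⟶ Y) (m : ℕ) (hm : n + 1 = m)
    (hf : P.complex.d m n ≫ f = 0) (r : R) :
    r • P.extMk f m hm hf = P.extMk (r • f) m hm (by simp [hf]) := by
  rw [Ext.smul_eq_comp_mk₀, extMk_comp_mk₀]
  congr 1
  simp

/-- The extension class of a cocycle. -/
def cocyclesExt : P.cocycles R Y n →ₗ[R] Abelian.Ext X Y n where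
  toFun z := P.extMk (P.cocyclesι R Y n z) (n + 1) rfl (P.d_comp_cocyclesι R Y n _ z)
  map_add' z z' := by simp [add_extMk]
  map_smul' r z := by simp [smul_extMk]

lemma cocyclesExt_surjective : Function.Surjective (P.cocyclesExt R Y n) := by
  intro x
  obtain ⟨f, hf, rfl⟩ := P.extMk_surjective x (n + 1) rfl
  obtain ⟨z, rfl⟩ := P.exists_cocyclesι_eq R Y n f hf
  exact ⟨z, rfl⟩

lemma ker_cocyclesExt :
    LinearMap.ker (P.cocyclesπ R Y n) = LinearMap.ker (P.cocyclesExt R Y n) := by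
  ext z
  rw [LinearMap.mem_ker, LinearMap.mem_ker, cocyclesπ_eq_zero_iff]
  obtain - | p := n
  · have hd : P.complex.d 0 ((ComplexShape.down ℕ).next 0) = 0 := P.complex.shape _ _ (by simp)
    rw [hd]
    simp only [Limits.zero_comp, exists_const]
    constructor
    · intro h
      have : z = 0 := P.cocyclesι_injective R Y 0 (h.symm.trans (map_zero _).symm)
      rw [this, map_zero]
    · exact fun h ↦ (P.extMk_zero_eq_zero _ 1 rfl (P.d_comp_cocyclesι R Y 0 1 z) h).symm
  · rw [ChainComplex.next_nat_succ]
    exact (P.extMk_eq_zero_iff _ _ rfl (P.d_comp_cocyclesι R Y (p + 1) _ z) p rfl).symm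

/-- Cohomology of the complex of morphisms from a projective resolution computes `Ext`. -/
def homologyLinearEquivExt :
    ((P.homComplexOp R Y).homology n).unop ≃ₗ[R] Abelian.Ext X Y n :=
  ((P.cocyclesπ R Y n).quotKerEquivOfSurjective (P.cocyclesπ_surjective R Y n)).symm ≪≫ₗ
    Submodule.quotEquivOfEq _ _ (P.ker_cocyclesExt R Y n) ≪≫ₗ
    (P.cocyclesExt R Y n).quotKerEquivOfSurjective (P.cocyclesExt_surjective R Y n)

lemma homologyLinearEquivExt_cocyclesπ (z : P.cocycles R Y n) :
    P.homologyLinearEquivExt R Y n (P.cocyclesπ R Y n z) = P.cocyclesExt R Y n z := by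
  have : ((P.cocyclesπ R Y n).quotKerEquivOfSurjective (P.cocyclesπ_surjective R Y n)).symm
      (P.cocyclesπ R Y n z) = Submodule.Quotient.mk z := by
    rw [LinearEquiv.symm_apply_eq]
    rfl
  simp only [homologyLinearEquivExt, LinearEquiv.trans_apply, this]
  rfl

variable [EnoughProjectives C]

/-- Comparison of `Ext` defined by left derived functors with `Ext` in the derived category. -/
def extLinearEquiv : ((_root_.Ext R C n).obj (op X)).obj Y ≃ₗ[R] Abelian.Ext X Y n :=
  (P.isoLeftDerivedObj ((linearYoneda R C).obj Y).rightOp n).unop.symm.toLinearEquiv ≪≫ₗ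
    P.homologyLinearEquivExt R Y n

lemma extLinearEquiv_isoLeftDerivedObj (y : ((P.homComplexOp R Y).homology n).unop) :
    P.extLinearEquiv R Y n
      ((P.isoLeftDerivedObj ((linearYoneda R C).obj Y).rightOp n).unop.toLinearEquiv y) =
      P.homologyLinearEquivExt R Y n y :=
  congr_arg (P.homologyLinearEquivExt R Y n)
    ((P.isoLeftDerivedObj ((linearYoneda R C).obj Y).rightOp n).unop.toLinearEquiv.symm_apply_apply
      y)

lemma extLinearEquiv_naturality {X' : C} (P' : ProjectiveResolution X') (g : X' ⟶ X)
    (x : ((_root_.Ext R C n).obj (op X)).obj Y) :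
    P'.extLinearEquiv R Y n ((((_root_.Ext R C n).map g.op).app Y).hom x) =
      (Ext.mk₀ g).comp (P.extLinearEquiv R Y n x) (zero_add n) := by
  let F := ((linearYoneda R C).obj Y).rightOp
  obtain ⟨x, rfl⟩ := (P.isoLeftDerivedObj F n).unop.toLinearEquiv.surjective x
  obtain ⟨z, rfl⟩ := P.cocyclesπ_surjective R Y n x
  let φ : Hom P' P g := ⟨lift g P' P, (lift_commutes_zero g P' P).trans (by simp)⟩
  let Φ : P'.homComplexOp R Y ⟶ P.homComplexOp R Y := (F.mapHomologicalComplex _).map φ.hom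
  let z' : P'.cocycles R Y n := (opcyclesMap Φ n).unop.hom z
  have h₁ : (((_root_.Ext R C n).map g.op).app Y).hom
      ((P.isoLeftDerivedObj F n).unop.toLinearEquiv (P.cocyclesπ R Y n z)) =
      (P'.isoLeftDerivedObj F n).unop.toLinearEquiv
        ((homologyMap Φ n).unop.hom (P.cocyclesπ R Y n z)) :=
    LinearMap.congr_fun (congr_arg ModuleCat.Hom.hom (congr_arg Quiver.Hom.unop
      (isoLeftDerivedObj_hom_naturality g P' P φ.hom (by simpa using φ.2) F n))) _
  have h₂ : P'.cocyclesπ R Y n z' = (homologyMap Φ n).unop.hom (P.cocyclesπ R Y n z) :=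
    (LinearMap.congr_fun (congr_arg ModuleCat.Hom.hom (congr_arg Quiver.Hom.unop
      (homologyι_naturality Φ n))) z).symm
  have h₃ : P'.cocyclesι R Y n z' = φ.hom.f n ≫ P.cocyclesι R Y n z :=
    LinearMap.congr_fun (congr_arg ModuleCat.Hom.hom (congr_arg Quiver.Hom.unop
      (p_opcyclesMap Φ n))) z
  have h₄ := mk₀_comp_extMk (P.cocyclesι R Y n z) (n + 1) rfl (P.d_comp_cocyclesι R Y n _ z) φ
  rw [h₁, ← h₂, extLinearEquiv_isoLeftDerivedObj, extLinearEquiv_isoLeftDerivedObj,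
    homologyLinearEquivExt_cocyclesπ, homologyLinearEquivExt_cocyclesπ]
  refine Eq.trans ?_ h₄.symm
  simp only [cocyclesExt, LinearMap.coe_mk, AddHom.coe_mk, h₃]

end CategoryTheory.ProjectiveResolution

end Comparison

section Comparison

open Opposite Limits

variable {R : Type u} [CommRing R] (a : Ideal R) (i : ℕ) (N : ModuleCat.{u} R)

/-- The directed system of `Ext` modules whose colimit is local cohomology. -/
abbrev localCohomologyDiagram : ℕᵒᵖᵒᵖ ⥤ ModuleCat.{u} R :=
  localCohomology.diagram (localCohomology.idealPowersDiagram a) i ⋙ (evaluation _ _).obj N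

/-- Each term of the directed system of `Ext` modules, in terms of the derived category. -/
def localCohomologyDiagramEquiv (k : ℕ) :
    (localCohomologyDiagram a i N).obj (op (op k)) ≃ₗ[R]
      Abelian.Ext (ModuleCat.of R (R ⧸ a ^ k)) N i :=
  (projectiveResolution (ModuleCat.of R (R ⧸ a ^ k))).extLinearEquiv R N i

lemma localCohomologyDiagramEquiv_map {k l : ℕ} (f : op (op k) ⟶ op (op l))
    (x : (localCohomologyDiagram a i N).obj (op (op k))) :
    localCohomologyDiagramEquiv a i N l (((localCohomologyDiagram a i N).map f).hom x) =
      extQuotPowMap a i N k l f.unop.unop.le (localCohomologyDiagramEquiv a i N k x) :=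
  (projectiveResolution (ModuleCat.of R (R ⧸ a ^ k))).extLinearEquiv_naturality R N i
    (projectiveResolution (ModuleCat.of R (R ⧸ a ^ l))) (quotPowMap a f.unop.unop.le) x

/-- The direct limit of the `Ext` modules, as a cocone. -/
def locCohModelCocone : Cocone (localCohomologyDiagram a i N) where
  pt := ModuleCat.of R (LocCohModel a i N)
  ι :=
    { app k := ModuleCat.ofHom (LocCohModel.of a i N k.unop.unop ∘ₗ
        (localCohomologyDiagramEquiv a i N k.unop.unop).toLinearMap)
      naturality k l f := by
        ext x
        refine (congr_arg (LocCohModel.of a i N l.unop.unop)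
          (localCohomologyDiagramEquiv_map a i N f x)).trans ?_
        exact Module.DirectLimit.of_f }

/-- The universal property of the direct limit of `Ext` modules. -/
def locCohModelDesc (s : Cocone (localCohomologyDiagram a i N)) : LocCohModel a i N →ₗ[R] s.pt :=
  Module.DirectLimit.lift R ℕ _ _
    (fun k ↦ (s.ι.app (op (op k))).hom ∘ₗ (localCohomologyDiagramEquiv a i N k).symm.toLinearMap)
    fun k l h x ↦ by
      obtain ⟨x, rfl⟩ := (localCohomologyDiagramEquiv a i N k).surjective x
      have h₁ := localCohomologyDiagramEquiv_map a i N (homOfLE h).op.op x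
      have h₂ := LinearMap.congr_fun (congr_arg ModuleCat.Hom.hom
        (s.w (homOfLE h).op.op)) x
      simp only [LinearMap.comp_apply, LinearEquiv.coe_coe, LinearEquiv.symm_apply_apply]
      refine Eq.trans ?_ h₂
      exact congr_arg (s.ι.app (op (op l))).hom
        ((LinearEquiv.symm_apply_eq _).2 h₁.symm)

lemma locCohModelDesc_of (s : Cocone (localCohomologyDiagram a i N)) (k : ℕ)
    (x : (localCohomologyDiagram a i N).obj (op (op k))) :
    locCohModelDesc a i N s (LocCohModel.of a i N k (localCohomologyDiagramEquiv a i N k x)) =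
      (s.ι.app (op (op k))).hom x := by
  rw [locCohModelDesc, Module.DirectLimit.lift_of]
  exact congr_arg (s.ι.app (op (op k))).hom (LinearEquiv.symm_apply_apply _ x)

/-- The direct limit of the `Ext` modules is a colimit. -/
def locCohModelCoconeIsColimit : IsColimit (locCohModelCocone a i N) where
  desc s := ModuleCat.ofHom (locCohModelDesc a i N s)
  fac s k := ModuleCat.hom_ext (LinearMap.ext fun x ↦ locCohModelDesc_of a i N s k.unop.unop x)
  uniq s m hm := by
    refine ModuleCat.hom_ext (LinearMap.ext fun x ↦ ?_)
    obtain ⟨k, x, rfl⟩ := Module.DirectLimit.exists_of x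
    obtain ⟨x, rfl⟩ := (localCohomologyDiagramEquiv a i N k).surjective x
    exact (LinearMap.congr_fun (congr_arg ModuleCat.Hom.hom (hm (op (op k)))) x).trans
      (locCohModelDesc_of a i N s k x).symm

/-- Local cohomology is the direct limit of `Ext` modules in the sense of the derived category. -/
def localCohomologyEquiv : (localCohomology a i).obj N ≃ₗ[R] LocCohModel a i N :=
  ((isColimitOfPreserves ((evaluation _ _).obj N) (colimit.isColimit
    (localCohomology.diagram (localCohomology.idealPowersDiagram a) i))).coconePointUniqueUpToIso
      (locCohModelCoconeIsColimit a i N)).toLinearEquiv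

end Comparison

section Torsion

variable {R : Type u} [CommRing R] (a : Ideal R)

/-- The submodule of elements annihilated by some power of an ideal. -/
def powTorsion (N : Type*) [AddCommGroup N] [Module R N] : Submodule R N where
  carrier := {x | ∃ k : ℕ, ∀ r ∈ a ^ k, r • x = 0}
  zero_mem' := ⟨0, by simp⟩
  add_mem' := by
    rintro x y ⟨k, hk⟩ ⟨l, hl⟩
    refine ⟨k + l, fun r hr ↦ ?_⟩
    rw [smul_add, hk _ (Ideal.pow_le_pow_right (Nat.le_add_right k l) hr),
      hl _ (Ideal.pow_le_pow_right (Nat.le_add_left l k) hr), add_zero]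
  smul_mem' := by
    rintro s x ⟨k, hk⟩
    exact ⟨k, fun r hr ↦ by rw [smul_comm, hk r hr, smul_zero]⟩

lemma mem_powTorsion {N : Type*} [AddCommGroup N] [Module R N] {x : N} :
    x ∈ powTorsion a N ↔ ∃ k : ℕ, ∀ r ∈ a ^ k, r • x = 0 :=
  Iff.rfl

lemma powTorsion_powTorsion (N : Type*) [AddCommGroup N] [Module R N] :
    powTorsion a (powTorsion a N) = ⊤ := by
  refine eq_top_iff.2 fun x _ ↦ ?_
  obtain ⟨k, hk⟩ := (mem_powTorsion a).1 x.2
  exact ⟨k, fun r hr ↦ Subtype.ext (hk r hr)⟩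

lemma map_mem_powTorsion {N N' : Type*} [AddCommGroup N] [Module R N] [AddCommGroup N']
    [Module R N'] (f : N →ₗ[R] N') {x : N} (hx : x ∈ powTorsion a N) : f x ∈ powTorsion a N' := by
  obtain ⟨k, hk⟩ := hx
  exact ⟨k, fun r hr ↦ by rw [← map_smul, hk r hr, map_zero]⟩

lemma powTorsion_eq_top_of_surjective {N N' : Type*} [AddCommGroup N] [Module R N]
    [AddCommGroup N'] [Module R N'] {f : N →ₗ[R] N'} (hf : Function.Surjective f)
    (h : powTorsion a N = ⊤) : powTorsion a N' = ⊤ := by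
  refine eq_top_iff.2 fun x _ ↦ ?_
  obtain ⟨x, rfl⟩ := hf x
  exact map_mem_powTorsion a f (h ▸ Submodule.mem_top)

lemma exists_pow_smul_eq_zero_of_fg {N : Type*} [AddCommGroup N] [Module R N] {L : Submodule R N}
    (hL : L.FG) (h : L ≤ powTorsion a N) : ∃ k : ℕ, ∀ r ∈ a ^ k, ∀ x ∈ L, r • x = 0 := by
  induction L, hL using Submodule.fg_induction with
  | singleton x =>
    obtain ⟨k, hk⟩ := h (Submodule.mem_span_singleton_self x)
    refine ⟨k, fun r hr y hy ↦ ?_⟩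
    obtain ⟨s, rfl⟩ := Submodule.mem_span_singleton.1 hy
    rw [smul_comm, hk r hr, smul_zero]
  | sup L₁ _ L₂ _ h₁ h₂ =>
    obtain ⟨k, hk⟩ := h₁ (le_sup_left.trans h)
    obtain ⟨l, hl⟩ := h₂ (le_sup_right.trans h)
    refine ⟨k + l, fun r hr y hy ↦ ?_⟩
    obtain ⟨y₁, hy₁, y₂, hy₂, rfl⟩ := Submodule.mem_sup.1 hy
    rw [smul_add, hk _ (Ideal.pow_le_pow_right (Nat.le_add_right k l) hr) _ hy₁,
      hl _ (Ideal.pow_le_pow_right (Nat.le_add_left l k) hr) _ hy₂, add_zero]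

lemma injective_powTorsion [IsNoetherianRing R] (I : Type u) [AddCommGroup I] [Module R I]
    [Module.Injective R I] : Module.Injective R (powTorsion a I) := by
  refine Module.Baer.injective fun J g ↦ ?_
  obtain ⟨k, hk⟩ := exists_pow_smul_eq_zero_of_fg a (L := LinearMap.range g)
    (by rw [LinearMap.range_eq_map]; exact (Module.Finite.fg_top (R := R) (M := J)).map g)
    (by simp [powTorsion_powTorsion])
  obtain ⟨m, hm⟩ := a.exists_pow_inf_eq_pow_smul (M := R) J
  let φ : J →ₗ[R] R ⧸ a ^ (k + m) := (a ^ (k + m)).mkQ ∘ₗ J.subtype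
  have hφ : LinearMap.ker φ ≤ LinearMap.ker ((powTorsion a I).subtype ∘ₗ g) := by
    intro x hx
    have hx' : (x : R) ∈ a ^ (k + m) := (Submodule.Quotient.mk_eq_zero _).1 hx
    have h : (x : R) ∈ a ^ k • (a ^ m • ⊤ ⊓ J : Submodule R R) := by
      have := hm (k + m) (Nat.le_add_left m k)
      rw [Nat.add_sub_cancel] at this
      rw [← this]
      exact ⟨by simpa using hx', x.2⟩
    have h' : (x : R) ∈ (a ^ k • (⊤ : Submodule R J)).map J.subtype := by
      rw [Submodule.map_smul'', Submodule.map_top, Submodule.range_subtype]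
      exact Submodule.smul_mono le_rfl inf_le_right h
    obtain ⟨y, hy, hyx⟩ := h'
    obtain rfl : y = x := Subtype.ext hyx
    rw [LinearMap.mem_ker, LinearMap.comp_apply]
    have : g y = 0 :=
      (Submodule.smul_le.2 fun r hr z _ ↦ LinearMap.mem_ker.2 <| by
        rw [map_smul]
        exact hk r hr _ ⟨z, rfl⟩ : a ^ k • ⊤ ≤ LinearMap.ker g) hy
    rw [this, map_zero]
  obtain ⟨h, hh⟩ := Module.Injective.out ((LinearMap.ker φ).liftQ φ le_rfl)
    (LinearMap.ker_eq_bot.1 (Submodule.ker_liftQ_eq_bot' _ _ rfl)) ((LinearMap.ker φ).liftQ _ hφ)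
  refine ⟨LinearMap.toSpanSingleton R _ ⟨h (Submodule.Quotient.mk 1), k + m, fun r hr ↦ ?_⟩,
    fun x hx ↦ Subtype.ext ?_⟩
  · rw [← map_smul, ← Submodule.Quotient.mk_smul, (Submodule.Quotient.mk_eq_zero _).2 (by simpa),
      map_zero]
  · have := hh (Submodule.Quotient.mk ⟨x, hx⟩)
    simp only [Submodule.liftQ_apply] at this
    rw [LinearMap.toSpanSingleton_apply, Submodule.coe_smul, ← map_smul,
      ← Submodule.Quotient.mk_smul, smul_eq_mul, mul_one]
    exact this

end Torsion

section Model

variable {R : Type u} [CommRing R] (a : Ideal R)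

namespace LocCohModel

/-- The embedding of local cohomology in degree zero. -/
def ev (N : ModuleCat.{u} R) : LocCohModel a 0 N →ₗ[R] N :=
  Module.DirectLimit.lift R ℕ _ _
    (fun k ↦
      { toFun x := (Ext.linearEquiv₀ (R := R) x).hom (Submodule.Quotient.mk 1)
        map_add' x y := by simp
        map_smul' r x := by simp })
    fun k l h x ↦ by
      obtain ⟨f, rfl⟩ := (Ext.linearEquiv₀ (R := R)).symm.surjective x
      rw [Ext.linearEquiv₀_symm_apply, extQuotPowMap_apply]
      simp only [Ext.mk₀_comp_mk₀, LinearMap.coe_mk, AddHom.coe_mk]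
      rw [← Ext.linearEquiv₀_symm_apply (R := R), ← Ext.linearEquiv₀_symm_apply (R := R),
        LinearEquiv.apply_symm_apply, LinearEquiv.apply_symm_apply]
      rfl

lemma ev_of (N : ModuleCat.{u} R) (k : ℕ) (f : ModuleCat.of R (R ⧸ a ^ k) ⟶ N) :
    ev a N (of a 0 N k (Ext.mk₀ f)) = f.hom (Submodule.Quotient.mk 1) := by
  rw [ev, Module.DirectLimit.lift_of]
  simp only [LinearMap.coe_mk, AddHom.coe_mk]
  rw [← Ext.linearEquiv₀_symm_apply (R := R), LinearEquiv.apply_symm_apply]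

lemma exists_of_zero (N : ModuleCat.{u} R) (x : LocCohModel a 0 N) :
    ∃ (k : ℕ) (f : ModuleCat.of R (R ⧸ a ^ k) ⟶ N), of a 0 N k (Ext.mk₀ f) = x := by
  obtain ⟨k, x, rfl⟩ := Module.DirectLimit.exists_of x
  obtain ⟨f, rfl⟩ := (Ext.linearEquiv₀ (R := R)).symm.surjective x
  exact ⟨k, f, rfl⟩

lemma ev_map {N N' : ModuleCat.{u} R} (f : N ⟶ N') (x : LocCohModel a 0 N) :
    ev a N' (map a f 0 x) = f.hom (ev a N x) := by
  obtain ⟨k, g, rfl⟩ := exists_of_zero a N x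
  rw [comp_of, Ext.mk₀_comp_mk₀, ev_of, ev_of]
  rfl

lemma ev_injective (N : ModuleCat.{u} R) : Function.Injective (ev a N) := by
  rw [injective_iff_map_eq_zero]
  intro x hx
  obtain ⟨k, f, rfl⟩ := exists_of_zero a N x
  rw [ev_of] at hx
  have : f = 0 := by
    refine ModuleCat.hom_ext (LinearMap.ext fun y ↦ ?_)
    obtain ⟨y, rfl⟩ := Submodule.Quotient.mk_surjective _ y
    rw [← mul_one y, ← smul_eq_mul, Submodule.Quotient.mk_smul, map_smul, hx]
    simp
  rw [this, Ext.mk₀_zero, map_zero]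

lemma ev_mem_powTorsion (N : ModuleCat.{u} R) (x : LocCohModel a 0 N) :
    ev a N x ∈ powTorsion a N :=
  map_mem_powTorsion a (ev a N) (exists_pow_smul_eq_zero a 0 N x)

lemma exists_ev_eq (N : ModuleCat.{u} R) {x : N} (hx : x ∈ powTorsion a N) :
    ∃ y, ev a N y = x := by
  obtain ⟨k, hk⟩ := hx
  let f : ModuleCat.of R (R ⧸ a ^ k) ⟶ N :=
    ModuleCat.ofHom (Submodule.liftQ _ (LinearMap.toSpanSingleton R N x) fun r hr ↦ hk r hr)
  refine ⟨of a 0 N k (Ext.mk₀ f), ?_⟩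
  rw [ev_of]
  exact (Submodule.liftQ_apply _ _ _).trans (one_smul R x)

instance finite_zero [IsNoetherianRing R] (N : ModuleCat.{u} R) [Module.Finite R N] :
    Module.Finite R (LocCohModel a 0 N) :=
  Module.Finite.of_injective (ev a N) (ev_injective a N)

end LocCohModel

end Model

lemma exists_injective_linearMap (R : Type u) [CommRing R] (N : Type u) [AddCommGroup N]
    [Module R N] : ∃ (E : Type u) (_ : AddCommGroup E) (_ : Module R E) (f : N →ₗ[R] E),
      Module.Injective R E ∧ Function.Injective f := by
  let I : ModuleCat.{u} R := Injective.under (ModuleCat.of R N)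
  let ι : ModuleCat.of R N ⟶ I := Injective.ι _
  have hI : Injective I := Injective.injective_under _
  have hι : Mono ι := Injective.ι_mono _
  exact ⟨I, inferInstance, inferInstance, ι.hom, (Module.injective_iff_injective_object R I).2 hI,
    (ModuleCat.mono_iff_injective _).1 hι⟩

section Cokernel

variable {R : Type u} [CommRing R] {N E : Type u} [AddCommGroup N] [Module R N] [AddCommGroup E]
  [Module R E] (f : N →ₗ[R] E)

/-- The cokernel sequence of a linear map. -/
abbrev cokerShortComplex : ShortComplex (ModuleCat.{u} R) :=
  ModuleCat.shortComplexOfCompEqZero f (LinearMap.range f).mkQ (LinearMap.range_mkQ_comp f)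

lemma cokerShortComplex_shortExact (hf : Function.Injective f) :
    (cokerShortComplex f).ShortExact :=
  ModuleCat.shortComplex_shortExact _ (LinearMap.exact_map_mkQ_range f) hf
    (Submodule.mkQ_surjective _)

end Cokernel

section Model

variable {R : Type u} [CommRing R] (a : Ideal R)

namespace LocCohModel

lemma subsingleton_of_powTorsion_eq_top [IsNoetherianRing R] (i : ℕ) :
    ∀ (N : Type u) [AddCommGroup N] [Module R N], powTorsion a N = ⊤ →
      Subsingleton (LocCohModel a (i + 1) (ModuleCat.of R N)) := by
  have key (N : Type u) [AddCommGroup N] [Module R N] (hN : powTorsion a N = ⊤) :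
      ∃ (E : Type u) (_ : AddCommGroup E) (_ : Module R E) (f : N →ₗ[R] E),
        Function.Injective f ∧ powTorsion a E = ⊤ ∧
        ∀ i, Subsingleton (LocCohModel a (i + 1) (ModuleCat.of R E)) := by
    obtain ⟨E, _, _, f, hE, hf⟩ := exists_injective_linearMap R N
    refine ⟨powTorsion a E, inferInstance, inferInstance,
      f.codRestrict _ fun x ↦ map_mem_powTorsion a f (hN ▸ Submodule.mem_top),
      fun x y h ↦ hf (congr_arg Subtype.val h), powTorsion_powTorsion a E, fun i ↦ ?_⟩
    have := injective_powTorsion a E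
    have := (Module.injective_iff_injective_object R (powTorsion a E)).1 this
    exact subsingleton_of_injective a _ i
  induction i with
  | zero =>
    intro N _ _ hN
    obtain ⟨E, _, _, f, hf, hE, hE'⟩ := key N hN
    have hS := cokerShortComplex_shortExact f hf
    refine subsingleton_of_forall_eq 0 fun x ↦ ?_
    have := hE' 0
    obtain ⟨y, rfl⟩ := (exact_δ_map a hS 0 x).1 (Subsingleton.elim _ _)
    obtain ⟨e, he⟩ := Submodule.mkQ_surjective _ (ev a _ y)
    obtain ⟨z, rfl⟩ := exists_ev_eq a (ModuleCat.of R E) (x := e) (hE ▸ Submodule.mem_top)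
    refine (exact_map_δ a hS 0 y).2 ⟨z, ev_injective a _ ?_⟩
    rw [ev_map]
    exact he
  | succ i ih =>
    intro N _ _ hN
    obtain ⟨E, _, _, f, hf, hE, hE'⟩ := key N hN
    have hS := cokerShortComplex_shortExact f hf
    refine subsingleton_of_forall_eq 0 fun x ↦ ?_
    have := hE' (i + 1)
    obtain ⟨y, rfl⟩ := (exact_δ_map a hS (i + 1) x).1 (Subsingleton.elim _ _)
    have := ih _ (powTorsion_eq_top_of_surjective a (Submodule.mkQ_surjective f.range) hE)
    rw [Subsingleton.elim y 0, map_zero]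

section Localization

variable (S : Submonoid R)

local notation "A" => Localization S

/-- The localization of a linear map. -/
abbrev locMap {N E : Type u} [AddCommGroup N] [Module R N] [AddCommGroup E] [Module R E]
    (f : N →ₗ[R] E) : LocalizedModule S N →ₗ[A] LocalizedModule S E :=
  IsLocalizedModule.mapExtendScalars S (LocalizedModule.mkLinearMap S N)
    (LocalizedModule.mkLinearMap S E) A f

lemma locMap_mk {N E : Type u} [AddCommGroup N] [Module R N] [AddCommGroup E] [Module R E]
    (f : N →ₗ[R] E) (x : N) (s : S) :
    locMap S f (LocalizedModule.mk x s) = LocalizedModule.mk (f x) s :=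
  IsLocalizedModule.map_LocalizedModules S f x s

/-- The localization of a cokernel sequence. -/
abbrev locCokerShortComplex {N E : Type u} [AddCommGroup N] [Module R N] [AddCommGroup E]
    [Module R E] (f : N →ₗ[R] E) : ShortComplex (ModuleCat.{u} A) :=
  ModuleCat.shortComplexOfCompEqZero (locMap S f) (locMap S (LinearMap.range f).mkQ)
    (LinearMap.ext fun x ↦
      ((LocalizedModule.map_exact S f (LinearMap.range f).mkQ
        (LinearMap.exact_map_mkQ_range f)) _).2 ⟨x, rfl⟩)

lemma locCokerShortComplex_shortExact {N E : Type u} [AddCommGroup N] [Module R N]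
    [AddCommGroup E] [Module R E] (f : N →ₗ[R] E) (hf : Function.Injective f) :
    (locCokerShortComplex S f).ShortExact :=
  ModuleCat.shortComplex_shortExact _
    (LocalizedModule.map_exact S f (LinearMap.range f).mkQ (LinearMap.exact_map_mkQ_range f))
    (IsLocalizedModule.map_injective S (LocalizedModule.mkLinearMap S N)
      (LocalizedModule.mkLinearMap S E) f hf)
    (IsLocalizedModule.map_surjective S (LocalizedModule.mkLinearMap S E)
      (LocalizedModule.mkLinearMap S _) _ (Submodule.mkQ_surjective _))

lemma smul_mk {N : Type u} [AddCommGroup N] [Module R N] (x : N) (r : R) (s : S) :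
    algebraMap R A r • LocalizedModule.mk x s = LocalizedModule.mk (r • x) s := by
  rw [algebraMap_smul, LocalizedModule.smul'_mk]

lemma mk_mem_powTorsion {N : Type u} [AddCommGroup N] [Module R N] {x : N}
    (hx : x ∈ powTorsion a N) :
    LocalizedModule.mk x 1 ∈ powTorsion (a.map (algebraMap R A)) (LocalizedModule S N) := by
  obtain ⟨k, hk⟩ := hx
  refine ⟨k, fun r hr ↦ ?_⟩
  rw [← Ideal.map_pow] at hr
  refine Submodule.span_induction ?_ (zero_smul _ _) ?_ ?_ hr
  · rintro _ ⟨r, hr, rfl⟩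
    rw [smul_mk, hk r hr, LocalizedModule.zero_mk]
  · intro y z _ _ hy hz
    rw [add_smul, hy, hz, add_zero]
  · intro b y _ hy
    rw [smul_eq_mul, mul_smul, hy, smul_zero]

lemma exists_smul_mem_powTorsion [IsNoetherianRing R] {N : Type u} [AddCommGroup N] [Module R N]
    {x : N} {s : S}
    (hx : LocalizedModule.mk x s ∈ powTorsion (a.map (algebraMap R A)) (LocalizedModule S N)) :
    ∃ u ∈ S, u • x ∈ powTorsion a N := by
  obtain ⟨k, hk⟩ := hx
  suffices ∀ J : Ideal R, J.FG → J ≤ a ^ k → ∃ u ∈ S, ∀ r ∈ J, r • u • x = 0 by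
    obtain ⟨u, hu, h⟩ := this _ (IsNoetherian.noetherian (a ^ k)) le_rfl
    exact ⟨u, hu, k, h⟩
  intro J hJ
  induction J, hJ using Submodule.fg_induction with
  | singleton r =>
    intro hr
    have hr : r ∈ a ^ k := hr (Submodule.mem_span_singleton_self r)
    have := hk (algebraMap R A r) (Ideal.map_pow (algebraMap R A) a k ▸ Ideal.mem_map_of_mem _ hr)
    rw [smul_mk, ← LocalizedModule.zero_mk s, LocalizedModule.mk_eq] at this
    obtain ⟨u, hu⟩ := this
    refine ⟨u * s, S.mul_mem u.2 s.2, fun r' hr' ↦ ?_⟩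
    obtain ⟨b, rfl⟩ := Submodule.mem_span_singleton.1 hr'
    have hu' : (u : R) • (s : R) • r • x = 0 := by
      simpa [Submonoid.smul_def] using hu
    calc (b • r) • ((u : R) * s) • x = b • (u : R) • (s : R) • r • x := by module
      _ = 0 := by rw [hu', smul_zero]
  | sup I J _ _ hI hJ =>
    intro h
    obtain ⟨u, hu, hu'⟩ := hI (le_sup_left.trans h)
    obtain ⟨v, hv, hv'⟩ := hJ (le_sup_right.trans h)
    refine ⟨u * v, S.mul_mem hu hv, fun r hr ↦ ?_⟩
    obtain ⟨b, hb, c, hc, rfl⟩ := Submodule.mem_sup.1 hr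
    calc (b + c) • (u * v) • x = v • b • u • x + u • c • v • x := by module
      _ = 0 := by rw [hu' b hb, hv' c hc, smul_zero, smul_zero, add_zero]

lemma exists_smul_smul_eq_zero_zero [IsNoetherianRing R] (k : ℕ) (N : Type u) [AddCommGroup N]
    [Module R N]
    (h : ∀ y : LocCohModel (a.map (algebraMap R A)) 0 (ModuleCat.of A (LocalizedModule S N)),
      ∀ r ∈ (a.map (algebraMap R A)) ^ k, r • y = 0)
    (x : LocCohModel a 0 (ModuleCat.of R N)) (r : R) (hr : r ∈ a ^ k) :
    ∃ s ∈ S, s • r • x = 0 := by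
  obtain ⟨y, hy⟩ := exists_ev_eq _ (ModuleCat.of A (LocalizedModule S N))
    (mk_mem_powTorsion a S (ev_mem_powTorsion a _ x))
  have := congr_arg (ev _ _) (h y _
    (Ideal.map_pow (algebraMap R A) a k ▸ Ideal.mem_map_of_mem _ hr))
  rw [map_smul, hy, map_zero] at this
  have h' : LocalizedModule.mk (r • ev a _ x) (1 : S) = LocalizedModule.mk 0 1 := by
    rw [← smul_mk, this, LocalizedModule.zero_mk]
  obtain ⟨s, hs⟩ := LocalizedModule.mk_eq.1 h'
  refine ⟨s, s.2, ev_injective a _ ?_⟩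
  rw [map_smul, map_smul, map_zero]
  rwa [one_smul, smul_zero, smul_zero, Submonoid.smul_def] at hs

lemma exists_smul_smul_mem_map_powTorsion [IsNoetherianRing R] {E C : Type u} [AddCommGroup E]
    [Module R E] [AddCommGroup C] [Module R C] (g : E →ₗ[R] C) {c : C}
    {e : LocalizedModule S E}
    (he : e ∈ powTorsion (a.map (algebraMap R A)) (LocalizedModule S E))
    (hec : locMap S g e = LocalizedModule.mk c 1) :
    ∃ s ∈ S, ∃ z ∈ powTorsion a E, g z = s • c := by
  induction e using LocalizedModule.induction_on with
  | h e s =>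
    rw [locMap_mk] at hec
    obtain ⟨u, hu, hue⟩ := exists_smul_mem_powTorsion a S he
    obtain ⟨w, hw⟩ := LocalizedModule.mk_eq.1 hec
    refine ⟨u * (w * s), S.mul_mem hu (S.mul_mem w.2 s.2), (w : R) • u • e,
      Submodule.smul_mem _ _ hue, ?_⟩
    rw [one_smul, Submonoid.smul_def, Submonoid.smul_def, Submonoid.smul_def] at hw
    rw [map_smul, map_smul, smul_comm, hw, mul_smul, mul_smul]

lemma exists_smul_smul_eq_zero_one [IsNoetherianRing R] (k : ℕ) (N : Type u) [AddCommGroup N]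
    [Module R N]
    (h : ∀ y : LocCohModel (a.map (algebraMap R A)) 1 (ModuleCat.of A (LocalizedModule S N)),
      ∀ r ∈ (a.map (algebraMap R A)) ^ k, r • y = 0)
    (x : LocCohModel a 1 (ModuleCat.of R N)) (r : R) (hr : r ∈ a ^ k) :
    ∃ s ∈ S, s • r • x = 0 := by
  obtain ⟨E, _, _, f, hE, hf⟩ := exists_injective_linearMap R N
  have hS := cokerShortComplex_shortExact f hf
  have hS' := locCokerShortComplex_shortExact S f hf
  have := (Module.injective_iff_injective_object R E).1 hE
  have := subsingleton_of_injective a (ModuleCat.of R E) 0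
  obtain ⟨c, rfl⟩ := (exact_δ_map a hS 0 x).1 (Subsingleton.elim _ _)
  obtain ⟨c', hc'⟩ := exists_ev_eq _ (ModuleCat.of A (LocalizedModule S (E ⧸ f.range)))
    (mk_mem_powTorsion a S (ev_mem_powTorsion a _ c))
  have h₁ := h (δ _ hS' 0 c') _
    (Ideal.map_pow (algebraMap R A) a k ▸ Ideal.mem_map_of_mem _ hr)
  rw [← map_smul] at h₁
  obtain ⟨e', he'⟩ := (exact_map_δ _ hS' 0 _).1 h₁
  have h₂ := congr_arg (ev _ _) he'
  rw [ev_map, map_smul] at h₂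
  have h₃ : locMap S f.range.mkQ (ev _ _ e') =
      LocalizedModule.mk (r • (ev a _ c : E ⧸ f.range)) 1 :=
    (h₂.trans (congr_arg _ hc')).trans (smul_mk S _ r 1)
  obtain ⟨s, hs, z, hz, hzs⟩ :=
    exists_smul_smul_mem_map_powTorsion a S f.range.mkQ (ev_mem_powTorsion _ _ e') h₃
  obtain ⟨y, rfl⟩ := exists_ev_eq a (ModuleCat.of R E) hz
  refine ⟨s, hs, ?_⟩
  rw [← map_smul, ← map_smul]
  refine (exact_map_δ a hS 0 _).2 ⟨y, ev_injective a _ ?_⟩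
  rw [ev_map, map_smul, map_smul]
  exact hzs

lemma exists_smul_smul_eq_zero [IsNoetherianRing R] (k i : ℕ) :
    ∀ (N : Type u) [AddCommGroup N] [Module R N],
      (∀ y : LocCohModel (a.map (algebraMap R A)) i (ModuleCat.of A (LocalizedModule S N)),
        ∀ r ∈ (a.map (algebraMap R A)) ^ k, r • y = 0) →
      ∀ (x : LocCohModel a i (ModuleCat.of R N)), ∀ r ∈ a ^ k, ∃ s ∈ S, s • r • x = 0 := by
  match i with
  | 0 => exact exists_smul_smul_eq_zero_zero a S k
  | 1 => exact exists_smul_smul_eq_zero_one a S k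
  | i + 2 =>
    intro N _ _ h x r hr
    obtain ⟨E, _, _, f, hE, hf⟩ := exists_injective_linearMap R N
    have hS := cokerShortComplex_shortExact f hf
    have hS' := locCokerShortComplex_shortExact S f hf
    have := (Module.injective_iff_injective_object R E).1 hE
    have := subsingleton_of_injective a (ModuleCat.of R E) (i + 1)
    obtain ⟨c, rfl⟩ := (exact_δ_map a hS (i + 1) x).1 (Subsingleton.elim _ _)
    have hE' : Module.Injective A (LocalizedModule S E) :=
      Module.injective_of_isLocalizedModule S (LocalizedModule.mkLinearMap S E)
    have := (Module.injective_iff_injective_object A (LocalizedModule S E)).1 hE'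
    have := subsingleton_of_injective (a.map (algebraMap R A))
      (ModuleCat.of A (LocalizedModule S E)) i
    obtain ⟨s, hs, hs'⟩ := exists_smul_smul_eq_zero k (i + 1) (E ⧸ f.range) (fun y r hr ↦ by
      have := h (δ _ hS' (i + 1) y) r hr
      rw [← map_smul] at this
      obtain ⟨e, he⟩ := (exact_map_δ _ hS' (i + 1) _).1 this
      rw [← he, Subsingleton.elim e 0, map_zero]) c r hr
    exact ⟨s, hs, by rw [← map_smul, ← map_smul, hs', map_zero]⟩

end Localization

end LocCohModel

end Model

section FiniteOn

variable {R : Type u} [CommRing R] (T : Set (PrimeSpectrum R))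

/-- A module is finite on a set `T` of primes if it has a finitely generated submodule such that
the localization of the quotient vanishes at all primes in `T`. -/
def FiniteOn (X : Type*) [AddCommGroup X] [Module R X] : Prop :=
  ∃ L : Submodule R X, L.FG ∧ ∀ p ∈ T, ∀ x, ∃ s ∉ p.asIdeal, s • x ∈ L

namespace FiniteOn

variable {X Y Z : Type*} [AddCommGroup X] [Module R X] [AddCommGroup Y] [Module R Y]
  [AddCommGroup Z] [Module R Z] {T}

lemma of_surjective (h : FiniteOn T X) (f : X →ₗ[R] Y) (hf : Function.Surjective f) :
    FiniteOn T Y := by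
  obtain ⟨L, hL, h⟩ := h
  refine ⟨L.map f, hL.map f, fun p hp y ↦ ?_⟩
  obtain ⟨x, rfl⟩ := hf y
  obtain ⟨s, hs, hsx⟩ := h p hp x
  exact ⟨s, hs, s • x, hsx, map_smul f s x⟩

lemma of_injective [IsNoetherianRing R] (h : FiniteOn T Y) (f : X →ₗ[R] Y)
    (hf : Function.Injective f) : FiniteOn T X := by
  obtain ⟨L, hL, h⟩ := h
  refine ⟨L.comap f, ?_, fun p hp x ↦ ?_⟩
  · have : Module.Finite R L := Module.Finite.iff_fg.2 hL
    exact Module.Finite.iff_fg.1 (Module.Finite.of_injective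
      (f.restrict (p := L.comap f) (q := L) fun _ h ↦ h) fun x y h ↦
        Subtype.ext (hf (congr_arg Subtype.val h)))
  · obtain ⟨s, hs, hsx⟩ := h p hp (f x)
    exact ⟨s, hs, by rwa [Submodule.mem_comap, map_smul]⟩

lemma of_exact [IsNoetherianRing R] (hX : FiniteOn T X) (hZ : FiniteOn T Z) (f : X →ₗ[R] Y)
    (g : Y →ₗ[R] Z) (h : Function.Exact f g) : FiniteOn T Y := by
  obtain ⟨L, hL, hX⟩ := hX
  obtain ⟨K, hK, hY⟩ := hZ.of_injective g.range.subtype Subtype.val_injective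
  obtain ⟨K', hK', rfl⟩ : ∃ K' : Submodule R Y, K'.FG ∧ K'.map g.rangeRestrict = K := by
    obtain ⟨s, rfl⟩ := hK
    refine ⟨Submodule.span R (Function.surjInv g.surjective_rangeRestrict '' s),
      Submodule.fg_span (s.finite_toSet.image _), ?_⟩
    rw [Submodule.map_span, Set.image_image]
    simp only [Function.surjInv_eq, Set.image_id']
  refine ⟨L.map f ⊔ K', (hL.map f).sup hK', fun p hp y ↦ ?_⟩
  obtain ⟨s, hs, k, hk, hks⟩ := hY p hp (g.rangeRestrict y)
  obtain ⟨x, hx⟩ := (h (s • y - k)).1 (by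
    rw [map_sub, map_smul, sub_eq_zero]
    exact (congr_arg Subtype.val hks).symm)
  obtain ⟨r, hr, hrx⟩ := hX p hp x
  refine ⟨r * s, p.2.mul_notMem hr hs, ?_⟩
  rw [show (r * s) • y = f (r • x) + r • k by rw [map_smul, hx]; module]
  exact add_mem (Submodule.mem_sup_left ⟨_, hrx, rfl⟩)
    (Submodule.mem_sup_right (K'.smul_mem r hk))

lemma directSum {ι : Type*} [Finite ι] {X : ι → Type*} [∀ i, AddCommGroup (X i)]
    [∀ i, Module R (X i)] (h : ∀ i, FiniteOn T (X i)) : FiniteOn T (⨁ i, X i) := by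
  classical
  choose L hL h using h
  refine ⟨⨆ i, (L i).map (DirectSum.lof R ι X i), Submodule.fg_iSup _ fun i ↦ (hL i).map _,
    fun p hp x ↦ ?_⟩
  induction x using DirectSum.induction_on with
  | zero => exact ⟨1, p.2.one_notMem, by simp⟩
  | of i x =>
    obtain ⟨s, hs, hsx⟩ := h i p hp x
    exact ⟨s, hs, Submodule.mem_iSup_of_mem i ⟨s • x, hsx, map_smul (DirectSum.lof R ι X i) s x⟩⟩
  | add x y hx hy =>
    obtain ⟨s, hs, hsx⟩ := hx
    obtain ⟨r, hr, hry⟩ := hy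
    refine ⟨r * s, p.2.mul_notMem hr hs, ?_⟩
    rw [show (r * s) • (x + y) = r • s • x + s • r • y by module]
    exact add_mem (Submodule.smul_mem _ _ hsx) (Submodule.smul_mem _ _ hry)

lemma pi {ι : Type*} [Finite ι] (h : FiniteOn T X) : FiniteOn T (ι → X) := by
  classical
  have := Fintype.ofFinite ι
  exact (directSum fun _ : ι ↦ h).of_surjective
    (DirectSum.linearEquivFunOnFintype R ι fun _ ↦ X).toLinearMap (LinearEquiv.surjective _)

lemma of_smul_mem [IsNoetherianRing R] (b : Ideal R) (Y : Submodule R X)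
    (hY : ∀ r ∈ b, ∀ x : X, r • x ∈ Y) (h : FiniteOn T Y)
    (h' : FiniteOn T (Submodule.torsionBySet R X b)) : FiniteOn T X := by
  obtain ⟨s, rfl⟩ := IsNoetherian.noetherian b
  refine h'.of_exact (h.pi (ι := s)) (Submodule.subtype _) (LinearMap.pi fun r : s ↦
    ((r : R) • LinearMap.id).codRestrict Y fun x ↦ hY r (Submodule.subset_span r.2) x)
    fun x ↦ ?_
  rw [Submodule.coe_subtype, Subtype.range_coe, SetLike.mem_coe,
    ← Submodule.torsionBySet_eq_torsionBySet_span, Submodule.mem_torsionBySet_iff, funext_iff]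
  exact forall_congr' fun r ↦ ⟨congr_arg Subtype.val, fun h ↦ Subtype.ext h⟩

lemma torsionBySet_inf_range [IsNoetherianRing R] (b : Ideal R) (g : X →ₗ[R] Y)
    (h : FiniteOn T g.ker) (h' : FiniteOn T (Submodule.torsionBySet R X b)) :
    FiniteOn T ↥(Submodule.torsionBySet R Y b ⊓ g.range) := by
  let D := (Submodule.torsionBySet R Y b).comap g
  have hD : FiniteOn T D := by
    refine of_smul_mem b (g.ker.comap D.subtype) (fun r hr x ↦ ?_) ?_ ?_
    · change g (r • x.1) = 0
      rw [map_smul]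
      exact (Submodule.mem_torsionBySet_iff _ _).1 x.2 ⟨r, hr⟩
    · exact h.of_injective (D.subtype.restrict fun _ h ↦ h) fun x y h ↦
        Subtype.ext (Subtype.ext (Subtype.ext_iff.1 h :))
    · refine h'.of_injective (D.subtype.restrict fun x hx ↦ ?_) fun x y h ↦
        Subtype.ext (Subtype.ext (Subtype.ext_iff.1 h :))
      rw [Submodule.mem_torsionBySet_iff] at hx ⊢
      exact fun r ↦ congr_arg Subtype.val (hx r)
  refine hD.of_surjective (g.restrict fun x hx ↦ ⟨hx, x, rfl⟩) ?_
  rintro ⟨_, hy, x, rfl⟩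
  exact ⟨⟨x, hy⟩, rfl⟩

lemma torsionBySet_of_injective [IsNoetherianRing R] {b : Ideal R}
    (h : FiniteOn T (Submodule.torsionBySet R Y b)) (f : X →ₗ[R] Y) (hf : Function.Injective f) :
    FiniteOn T (Submodule.torsionBySet R X b) := by
  refine h.of_injective (f.restrict fun x hx ↦ ?_) fun x y hxy ↦
    Subtype.ext (hf (Subtype.ext_iff.1 hxy :))
  rw [Submodule.mem_torsionBySet_iff] at hx ⊢
  exact fun r ↦ by rw [← map_smul, hx r, map_zero]

lemma finite_associatedPrimes [IsNoetherianRing R] (h : FiniteOn T X) :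
    {p ∈ T | p.asIdeal ∈ associatedPrimes R X}.Finite := by
  obtain ⟨L, hL, h⟩ := h
  have : Module.Finite R L := Module.Finite.iff_fg.2 hL
  refine ((associatedPrimes.finite R L).preimage
    (f := PrimeSpectrum.asIdeal) fun p _ q _ h ↦ PrimeSpectrum.ext h).subset ?_
  rintro p ⟨hp, hpX⟩
  refine (associatedPrimes.subset_union_of_exact L.subtype_injective
    (LinearMap.exact_subtype_mkQ L) hpX).resolve_right fun hpL ↦ ?_
  obtain ⟨-, x, hx⟩ := isAssociatedPrime_iff.1 hpL
  obtain ⟨x, rfl⟩ := L.mkQ_surjective x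
  obtain ⟨s, hs, hsx⟩ := h p hp x
  refine hs (hx ▸ Submodule.mem_colon_singleton.2 ?_)
  rwa [Submodule.mem_bot, ← map_smul, Submodule.mkQ_apply, Submodule.Quotient.mk_eq_zero]

lemma exists_forall_smul_smul_eq_zero [IsNoetherianRing R] (hT : IsLowerSet T) (a : Ideal R)
    (hfin : {p ∈ T | p.asIdeal ∈ associatedPrimes R X}.Finite)
    (h : ∀ p ∈ T, ∃ k, ∀ x : X, ∀ r ∈ a ^ k, ∃ s ∉ p.asIdeal, s • r • x = 0) :
    ∃ k, ∀ p ∈ T, ∀ x : X, ∀ r ∈ a ^ k, ∃ s ∉ p.asIdeal, s • r • x = 0 := by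
  choose! k hk using h
  obtain ⟨K, hK⟩ := (hfin.image k).bddAbove
  refine ⟨K, fun p hp x r hr ↦ ?_⟩
  by_contra! hx
  have hle : (Submodule.span R {r • x}).annihilator ≤ p.asIdeal := fun s hs ↦ by
    by_contra hsp
    exact hx s hsp ((Submodule.mem_annihilator_span_singleton _ _).1 hs)
  obtain ⟨q, hq, hqp⟩ := Ideal.exists_minimalPrimes_le hle
  have hqW := Module.associatedPrimes.minimalPrimes_annihilator_subset_associatedPrimes R _ hq
  have hqX := associatedPrimes.subset_of_injective (Submodule.subtype_injective _) hqW
  obtain ⟨hqp', ⟨w, hw⟩, hqw⟩ := isAssociatedPrime_iff.1 hqW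
  have hqT : (⟨q, hqp'⟩ : PrimeSpectrum R) ∈ T := hT (show _ ≤ p from hqp) hp
  obtain ⟨s, hs, hsx⟩ := hk _ hqT x r (Ideal.pow_le_pow_right (hK ⟨_, ⟨hqT, hqX⟩, rfl⟩) hr)
  refine hs ?_
  change s ∈ q
  rw [hqw, Submodule.mem_colon_singleton, Submodule.mem_bot]
  obtain ⟨c, rfl⟩ := Submodule.mem_span_singleton.1 hw
  exact Subtype.ext (by
    change s • c • r • x = 0
    rw [smul_comm, hsx, smul_zero])

lemma of_torsion [IsNoetherianRing R] (hT : IsLowerSet T) (a : Ideal R)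
    (hX : ∀ x : X, ∃ k, ∀ r ∈ a ^ k, r • x = 0)
    (hfin : ∀ k, FiniteOn T (Submodule.torsionBySet R X (a ^ k : Ideal R)))
    (h : ∀ p ∈ T, ∃ k, ∀ x : X, ∀ r ∈ a ^ k, ∃ s ∉ p.asIdeal, s • r • x = 0) :
    FiniteOn T X := by
  have this (p : PrimeSpectrum R) (hpX : p.asIdeal ∈ associatedPrimes R X) :
      p.asIdeal ∈ associatedPrimes R (Submodule.torsionBySet R X (a ^ 1 : Ideal R)) := by
    obtain ⟨-, x, hx⟩ := isAssociatedPrime_iff.1 hpX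
    obtain ⟨l, hl⟩ := hX x
    have ha : a ≤ p.asIdeal := p.2.le_of_pow_le (n := l) fun r hr ↦
      hx ▸ Submodule.mem_colon_singleton.2 (hl r hr)
    have hxa : x ∈ Submodule.torsionBySet R X (a ^ 1 : Ideal R) := by
      rw [Submodule.mem_torsionBySet_iff, pow_one]
      exact fun r ↦ (Submodule.mem_bot R).1 (Submodule.mem_colon_singleton.1 (hx.le (ha r.2)))
    refine isAssociatedPrime_iff.2 ⟨p.2, ⟨x, hxa⟩, ?_⟩
    ext r
    rw [hx, Submodule.mem_colon_singleton, Submodule.mem_colon_singleton, Submodule.mem_bot,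
      Submodule.mem_bot, Subtype.ext_iff]
    rfl
  obtain ⟨k, hk⟩ := exists_forall_smul_smul_eq_zero hT a
    ((hfin 1).finite_associatedPrimes.subset fun p ⟨hp, hpX⟩ ↦ ⟨hp, this p hpX⟩) h
  refine of_smul_mem (a ^ k) (a ^ k • ⊤)
    (fun r hr x ↦ Submodule.smul_mem_smul hr Submodule.mem_top)
    ⟨⊥, Submodule.fg_bot, fun p hp y ↦ ?_⟩ (hfin k)
  obtain ⟨y, hy⟩ := y
  suffices ∃ s ∉ p.asIdeal, s • y = 0 by
    obtain ⟨s, hs, hsy⟩ := this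
    exact ⟨s, hs, Subtype.ext hsy⟩
  induction hy using Submodule.smul_induction_on' with
  | smul r hr x _ => exact hk p hp x r hr
  | add x _ y _ hx hy =>
    obtain ⟨s, hs, hsx⟩ := hx
    obtain ⟨r, hr, hry⟩ := hy
    refine ⟨r * s, p.2.mul_notMem hr hs, ?_⟩
    rw [show (r * s) • (x + y) = r • s • x + s • r • y by module, hsx, hry, smul_zero,
      smul_zero, add_zero]

end FiniteOn

end FiniteOn

section Finiteness

variable {R : Type u} [CommRing R] (a : Ideal R)

lemma powTorsion_quotient_powTorsion [IsNoetherianRing R] (N : Type*) [AddCommGroup N] [Module R N]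
    [Module.Finite R N] : powTorsion a (N ⧸ powTorsion a N) = ⊥ := by
  obtain ⟨l, hl⟩ := exists_pow_smul_eq_zero_of_fg a
    (IsNoetherian.noetherian (powTorsion a N)) le_rfl
  refine eq_bot_iff.2 fun x ⟨k, hk⟩ ↦ ?_
  obtain ⟨x, rfl⟩ := Submodule.mkQ_surjective _ x
  rw [Submodule.mem_bot, Submodule.mkQ_apply, Submodule.Quotient.mk_eq_zero]
  refine ⟨l + k, fun r hr ↦ ?_⟩
  rw [pow_add] at hr
  induction hr using Submodule.mul_induction_on' with
  | mem_mul_mem r hr s hs =>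
    rw [mul_smul]
    refine hl r hr _ ?_
    rw [← Submodule.Quotient.mk_eq_zero, ← Submodule.mkQ_apply, map_smul, hk s hs]
  | add r _ s _ hr hs => rw [add_smul, hr, hs, add_zero]

lemma exists_isSMulRegular_of_powTorsion_eq_bot [IsNoetherianRing R] {N : Type*}
    [AddCommGroup N] [Module R N] [Module.Finite R N] (h : powTorsion a N = ⊥) (k : ℕ) : ∃ x ∈ a ^ k, IsSMulRegular N x := by
  by_contra! hx
  obtain ⟨p, hp, hle⟩ := (Ideal.subset_union_prime_finite (associatedPrimes.finite R N)
    (f := id) (I := a ^ k) ⊤ ⊤ fun I hI _ _ ↦ hI.isPrime).1 (by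
      change _ ⊆ ⋃ p ∈ associatedPrimes R N, (p : Set R)
      rw [biUnion_associatedPrimes_eq_compl_regular R N]
      exact fun r hr ↦ hx r hr)
  obtain ⟨hp, y, hy⟩ := isAssociatedPrime_iff.1 hp
  have hyt : y ∈ powTorsion a N := ⟨k, fun r hr ↦
    (Submodule.mem_bot R).1 (Submodule.mem_colon_singleton.1 (hy.le (hle hr)))⟩
  rw [h, Submodule.mem_bot] at hyt
  refine hp.one_notMem (hy.ge (Submodule.mem_colon_singleton.2 ?_))
  rw [hyt, smul_zero]
  exact Submodule.zero_mem _

namespace LocCohModel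

variable {T : Set (PrimeSpectrum R)}

section QuotientTorsion

variable (N : Type u) [AddCommGroup N] [Module R N]

/-- The exact sequence of a module, its torsion submodule and the quotient. -/
abbrev powTorsionShortComplex : ShortComplex (ModuleCat.{u} R) :=
  ModuleCat.shortComplexOfCompEqZero (powTorsion a N).subtype (powTorsion a N).mkQ
    (LinearMap.exact_subtype_mkQ _).linearMap_comp_eq_zero

lemma powTorsionShortComplex_shortExact : (powTorsionShortComplex a N).ShortExact :=
  ModuleCat.shortComplex_shortExact _ (LinearMap.exact_subtype_mkQ _)
    (Submodule.subtype_injective _) (Submodule.mkQ_surjective _)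

lemma map_mkQ_powTorsion_surjective [IsNoetherianRing R] (i : ℕ) :
    Function.Surjective (map a (powTorsionShortComplex a N).g i) := fun x ↦ by
  have := subsingleton_of_powTorsion_eq_top a i _ (powTorsion_powTorsion a N)
  exact (exact_map_δ a (powTorsionShortComplex_shortExact a N) i x).1 (Subsingleton.elim _ _)

lemma map_mkQ_powTorsion_injective [IsNoetherianRing R] (i : ℕ) :
    Function.Injective (map a (powTorsionShortComplex a N).g (i + 1)) := by
  have := subsingleton_of_powTorsion_eq_top a i _ (powTorsion_powTorsion a N)
  refine (injective_iff_map_eq_zero _).2 fun x hx ↦ ?_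
  obtain ⟨y, rfl⟩ :=
    (exact_map_map a (powTorsionShortComplex_shortExact a N) (i + 1) x).1 hx
  rw [Subsingleton.elim y 0, map_zero]

end QuotientTorsion

lemma finiteOn_torsionBySet_of_shortExact [IsNoetherianRing R] {S : ShortComplex (ModuleCat.{u} R)}
    (hS : S.ShortExact) (b : Ideal R) (i : ℕ) (h₂ : FiniteOn T (LocCohModel a i S.X₂))
    (h₃ : FiniteOn T (Submodule.torsionBySet R (LocCohModel a i S.X₃) b))
    (hb : ∀ y ∈ Submodule.torsionBySet R (LocCohModel a (i + 1) S.X₁) b,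
      map a S.f (i + 1) y = 0) :
    FiniteOn T (Submodule.torsionBySet R (LocCohModel a (i + 1) S.X₁) b) := by
  have hker : FiniteOn T (δ a hS i).ker :=
    h₂.of_surjective ((map a S.g i).codRestrict _ fun y ↦ (exact_map_δ a hS i _).2 ⟨y, rfl⟩)
      fun ⟨y, hy⟩ ↦ by
        obtain ⟨z, rfl⟩ := (exact_map_δ a hS i y).1 hy
        exact ⟨z, rfl⟩
  have := FiniteOn.torsionBySet_inf_range b (δ a hS i) hker h₃
  rwa [inf_eq_left.2 fun y hy ↦ (exact_δ_map a hS i y).1 (hb y hy)] at this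

lemma finiteOn_torsionBySet_of_isSMulRegular [IsNoetherianRing R] (Q : Type u) [AddCommGroup Q]
    [Module R Q] {b : Ideal R} {x : R} (hx : x ∈ b) (hxQ : IsSMulRegular Q x) (i : ℕ)
    (h : FiniteOn T (LocCohModel a i (ModuleCat.of R Q)))
    (h' : FiniteOn T (Submodule.torsionBySet R (LocCohModel a i
      (ModuleCat.of R (Q ⧸ LinearMap.range (x • LinearMap.id : Q →ₗ[R] Q)))) b)) :
    FiniteOn T (Submodule.torsionBySet R (LocCohModel a (i + 1) (ModuleCat.of R Q)) b) := by
  have key (y) (hy : y ∈ Submodule.torsionBySet R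
      (LocCohModel a (i + 1) (ModuleCat.of R Q)) b) :
      map a (x • 𝟙 (ModuleCat.of R Q)) (i + 1) y = 0 := by
    rw [map_smul_id]
    exact (Submodule.mem_torsionBySet_iff _ _).1 hy ⟨x, hx⟩
  exact finiteOn_torsionBySet_of_shortExact a
    (cokerShortComplex_shortExact (x • LinearMap.id : Q →ₗ[R] Q) fun _ _ h ↦ hxQ h) b i h h' key

lemma finiteOn_torsionBySet [IsNoetherianRing R] (i : ℕ) :
    ∀ (N : Type u) [AddCommGroup N] [Module R N] [Module.Finite R N],
      (∀ j < i, FiniteOn T (LocCohModel a j (ModuleCat.of R N))) → ∀ k : ℕ,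
      FiniteOn T
        (Submodule.torsionBySet R (LocCohModel a i (ModuleCat.of R N)) (a ^ k : Ideal R)) := by
  induction i with
  | zero =>
    intro N _ _ _ _ k
    have : Module.Finite R (LocCohModel a 0 (ModuleCat.of R N)) := finite_zero a _
    exact FiniteOn.of_injective (Y := LocCohModel a 0 (ModuleCat.of R N))
      ⟨⊤, Module.Finite.fg_top, fun p _ x ↦ ⟨1, p.2.one_notMem, Submodule.mem_top⟩⟩
      (Submodule.subtype _) (Submodule.subtype_injective _)
  | succ i ih =>
    intro N _ _ _ h k
    let Q := N ⧸ powTorsion a N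
    have hQ (j : ℕ) (hj : j < i + 1) : FiniteOn T (LocCohModel a j (ModuleCat.of R Q)) :=
      (h j hj).of_surjective _ (map_mkQ_powTorsion_surjective a N j)
    obtain ⟨x, hx, hxQ⟩ :=
      exists_isSMulRegular_of_powTorsion_eq_bot a (powTorsion_quotient_powTorsion a N) k
    have hS := cokerShortComplex_shortExact (x • LinearMap.id : Q →ₗ[R] Q) fun _ _ h ↦ hxQ h
    have hC := ih (Q ⧸ LinearMap.range (x • LinearMap.id : Q →ₗ[R] Q)) (fun j hj ↦
      (hQ j (hj.trans (Nat.lt_succ_self i))).of_exact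
      (hQ (j + 1) (Nat.succ_lt_succ hj)) _ _ (exact_map_δ a hS j)) k
    have hQ' := finiteOn_torsionBySet_of_isSMulRegular a Q hx hxQ i (hQ i (Nat.lt_succ_self i)) hC
    exact hQ'.torsionBySet_of_injective _ (map_mkQ_powTorsion_injective a N i)

lemma finiteOn [IsNoetherianRing R] (hT : IsLowerSet T) (N : Type u) [AddCommGroup N] [Module R N]
    [Module.Finite R N] (t : ℕ)
    (h : ∀ i < t, ∀ p ∈ T, ∃ k, ∀ x : LocCohModel a i (ModuleCat.of R N), ∀ r ∈ a ^ k,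
      ∃ s ∉ p.asIdeal, s • r • x = 0) (i : ℕ) (hi : i < t) :
    FiniteOn T (LocCohModel a i (ModuleCat.of R N)) := by
  induction i using Nat.strong_induction_on with
  | _ i ih =>
    exact FiniteOn.of_torsion hT a (exists_pow_smul_eq_zero a i _)
      (finiteOn_torsionBySet a i N fun j hj ↦ ih j hj (hj.trans hi)) (h i hi)

end LocCohModel

end Finiteness

end LocalCohomologyFiniteness

section Support

variable {R : Type u} [CommRing R] (a : Ideal R)

namespace LocCohModel

lemma exists_smul_smul_eq_zero_of_notMem_support [IsNoetherianRing R] (N : Type u)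
    [AddCommGroup N] [Module R N] [Module.Finite R N] (p : PrimeSpectrum R)
    (hp : p ∉ Module.support R (N ⧸ (a • ⊤ : Submodule R N))) (i : ℕ)
    (x : LocCohModel a i (ModuleCat.of R N)) (r : R) : ∃ s ∉ p.asIdeal, s • r • x = 0 := by
  rw [Module.support_quotient, Set.mem_inter_iff, not_and_or] at hp
  rcases hp with hp | hp
  · rw [Module.mem_support_iff_of_finite, SetLike.not_le_iff_exists] at hp
    obtain ⟨s, hs, hsp⟩ := hp
    refine ⟨s, hsp, ?_⟩
    have : s • 𝟙 (ModuleCat.of R N) = (0 : R) • 𝟙 (ModuleCat.of R N) := by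
      ext y
      exact (Module.mem_annihilator.1 hs y).trans (zero_smul R y).symm
    rw [← map_smul_id a _ s, this, map_smul_id, zero_smul]
  · obtain ⟨s, hs, hsp⟩ := SetLike.not_le_iff_exists.1 (show ¬ a ≤ p.asIdeal from hp)
    obtain ⟨k, hk⟩ := exists_pow_smul_eq_zero a i _ x
    refine ⟨s ^ k, fun h ↦ hsp (p.2.mem_of_pow_mem k h), ?_⟩
    rw [smul_comm, hk _ (Ideal.pow_mem_pow hs k), smul_zero]

end LocCohModel

lemma exists_pow_smul_eq_zero_of_finite (i : ℕ) (N : ModuleCat.{u} R)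
    [Module.Finite R ((localCohomology a i).obj N)] :
    ∃ k, ∀ y : LocCohModel a i N, ∀ r ∈ a ^ k, r • y = 0 := by
  have := Module.Finite.equiv (localCohomologyEquiv a i N)
  obtain ⟨k, hk⟩ := exists_pow_smul_eq_zero_of_fg a (L := (⊤ : Submodule R (LocCohModel a i N)))
    Module.Finite.fg_top fun x _ ↦ LocCohModel.exists_pow_smul_eq_zero a i N x
  exact ⟨k, fun y r hr ↦ hk r hr y Submodule.mem_top⟩

end Support

lemma finite_locCoh_of_lt_finDim {R : Type} [CommRing R] {a : Ideal R} {M : Type}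
    [AddCommGroup M] [Module R M] {i : ℕ} (h : (i : ℕ∞) < finDim R a M) :
    Module.Finite R ↥(locCoh R a i M) := by
  by_contra hi
  exact h.not_ge (sInf_le ⟨i, hi, rfl⟩)

lemma isLowerSet_le_ringKrullDim_quotient (R : Type*) [CommRing R] (n : WithBot ℕ∞) :
    IsLowerSet {p : PrimeSpectrum R | n ≤ ringKrullDim (R ⧸ p.asIdeal)} := fun p q hqp hp ↦
  le_trans hp (ringKrullDim_le_of_surjective
    (Ideal.Quotient.factor (show q.asIdeal ≤ p.asIdeal from hqp))
    (Ideal.Quotient.factor_surjective hqp))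

lemma finiteOn_locCoh {R : Type} [CommRing R] [IsNoetherianRing R] (a : Ideal R) (M : Type)
    [AddCommGroup M] [Module R M] [Module.Finite R M] {n t : ℕ}
    (ht : (t : ℕ∞) ≤ finDimN R a n M) {i : ℕ} (hi : i < t) :
    FiniteOn {p : PrimeSpectrum R | (n : WithBot ℕ∞) ≤ ringKrullDim (R ⧸ p.asIdeal)}
      ↥(locCoh R a i M) := by
  refine (LocCohModel.finiteOn a (isLowerSet_le_ringKrullDim_quotient R n) M t
    (fun i hi p hp ↦ ?_) i hi).of_surjective
    (localCohomologyEquiv a i (ModuleCat.of R M)).symm.toLinearMap (LinearEquiv.surjective _)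
  by_cases hpM : p ∈ Module.support R (M ⧸ (a • ⊤ : Submodule R M))
  · have hfin := finite_locCoh_of_lt_finDim
      ((Nat.cast_lt.2 hi).trans_le (ht.trans (sInf_le ⟨p, hpM, hp, rfl⟩)))
    obtain ⟨k, hk⟩ := @exists_pow_smul_eq_zero_of_finite _ _
      (a.map (algebraMap R (Localization.AtPrime p.asIdeal))) i _ hfin
    exact ⟨k, LocCohModel.exists_smul_smul_eq_zero a p.asIdeal.primeCompl k i M hk⟩
  · exact ⟨0, fun x r _ ↦
      LocCohModel.exists_smul_smul_eq_zero_of_notMem_support a M p hpM i x r⟩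

/-- If `t = f_a^n(M)` is finite, then for every submodule `N` of `⊕_{i=0}^{t-1} H^i_a(M)`,
the set `(Ass_R(⊕_{i=0}^{t-1} H^i_a(M) / N))_{≥ n}` is finite. -/
theorem finite_assPrimes_quotient_directSum_locCoh (R : Type) [CommRing R] [IsNoetherianRing R]
    (a : Ideal R) (M : Type) [AddCommGroup M] [Module R M] [Module.Finite R M]
    (n t : ℕ) (ht : finDimN R a n M = (t : ℕ∞))
    (N : Submodule R (⨁ i : Fin t, ↥(locCoh R a (i : ℕ) M))) :
    {p ∈ associatedPrimes R ((⨁ i : Fin t, ↥(locCoh R a (i : ℕ) M)) ⧸ N) |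
      (n : WithBot ℕ∞) ≤ ringKrullDim (R ⧸ p)}.Finite := by
  have h := ((FiniteOn.directSum fun i : Fin t ↦ finiteOn_locCoh a M ht.ge i.2).of_surjective
    N.mkQ N.mkQ_surjective).finite_associatedPrimes
  exact (h.image PrimeSpectrum.asIdeal).subset fun p ⟨hp, hn⟩ ↦ ⟨⟨p, hp.isPrime⟩, ⟨hn, hp⟩, rfl⟩
end
end

section
/- Let R be a commutative Noetherian ring and n a non-negative integer. Let M and N be R-modules with M finitely generated and N in dimension < n. Then Ext_R^i(M, N) is in dimension < n for every i ≥ 0. -/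
open CategoryTheory

noncomputable section

section InDimLT

variable {R : Type} [CommRing R] {n : ℕ} {A B : Type} [AddCommGroup A] [Module R A]
  [AddCommGroup B] [Module R B]

/-- The Krull dimension of a set of primes is monotone with respect to inclusion. -/
lemma krullDim_coe_mono {α : Type*} [Preorder α] {s t : Set α} (h : s ⊆ t) :
    Order.krullDim s ≤ Order.krullDim t :=
  Order.krullDim_le_of_strictMono (Set.inclusion h) fun _ _ hab ↦ hab

lemma InDimLT.of_injective [IsNoetherianRing R] (hB : InDimLT R B n) (f : A →ₗ[R] B)
    (hf : Function.Injective f) : InDimLT R A n := by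
  obtain ⟨N, hN, hdim⟩ := hB
  refine ⟨N.comap f, ?_, (krullDim_coe_mono (Module.support_subset_of_injective
    ((N.comap f).mapQ N f le_rfl) ?_)).trans_lt hdim⟩
  · have : Module.Finite R N := Module.Finite.iff_fg.mpr hN
    rw [← Module.Finite.iff_fg]
    refine Module.Finite.of_injective (f.restrict (p := N.comap f) (q := N) fun _ hx ↦ hx) ?_
    intro x y hxy
    exact Subtype.ext (hf (congrArg Subtype.val hxy))
  · rw [← LinearMap.ker_eq_bot, Submodule.ker_mapQ, Submodule.mkQ_map_self]

lemma InDimLT.of_surjective (hA : InDimLT R A n) (f : A →ₗ[R] B)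
    (hf : Function.Surjective f) : InDimLT R B n := by
  obtain ⟨N, hN, hdim⟩ := hA
  refine ⟨N.map f, hN.map f, (krullDim_coe_mono (Module.support_subset_of_surjective
    (N.mapQ (N.map f) f (Submodule.le_comap_map f N)) ?_)).trans_lt hdim⟩
  intro y
  obtain ⟨y, rfl⟩ := Submodule.Quotient.mk_surjective _ y
  obtain ⟨x, rfl⟩ := hf y
  exact ⟨Submodule.Quotient.mk x, rfl⟩

lemma support_pi_subset (ι : Type) [Finite ι] :
    Module.support R (ι → A) ⊆ Module.support R A := by
  intro p
  contrapose
  simp only [Module.notMem_support_iff']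
  intro h m
  have := Fintype.ofFinite ι
  choose r hr hrm using fun i ↦ h (m i)
  refine ⟨∏ i, r i, p.asIdeal.primeCompl.prod_mem fun i _ ↦ hr i, ?_⟩
  ext i
  obtain ⟨c, hc⟩ := Finset.dvd_prod_of_mem r (Finset.mem_univ i)
  rw [Pi.smul_apply, hc, mul_comm, mul_smul, hrm, smul_zero, Pi.zero_apply]

lemma InDimLT.pi (hA : InDimLT R A n) (ι : Type) [Finite ι] :
    InDimLT R (ι → A) n := by
  classical
  obtain ⟨N, hN, hdim⟩ := hA
  have := Fintype.ofFinite ι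
  refine ⟨Submodule.pi Set.univ fun _ ↦ N, Submodule.fg_pi fun _ ↦ hN, ?_⟩
  rw [(Submodule.quotientPi fun _ : ι ↦ N).support_eq]
  exact (krullDim_coe_mono (support_pi_subset ι)).trans_lt hdim

lemma InDimLT.linearMap [IsNoetherianRing R] [Module.Finite R A] (hB : InDimLT R B n) :
    InDimLT R (A →ₗ[R] B) n := by
  obtain ⟨k, f, hf⟩ := Module.Finite.exists_fin' R A
  let e : (Fin k → B) ≃ₗ[R] ((Fin k → R) →ₗ[R] B) := (Pi.basisFun R (Fin k)).constr R
  exact (hB.pi (Fin k)).of_injective (e.symm.toLinearMap ∘ₗ LinearMap.lcomp R B f)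
    (e.symm.injective.comp fun _ _ h ↦ (LinearMap.cancel_right hf).mp h)

end InDimLT

section FiniteResolution

open Limits

universe u

variable {R : Type u} [CommRing R]

/-- Every module is a quotient of a projective module, which can be chosen to be finitely
generated if the given module is. -/
lemma ModuleCat.exists_projective_cover (X : ModuleCat.{u} R) :
    ∃ (P : ModuleCat.{u} R) (π : P ⟶ X), Projective P ∧ Epi π ∧
      (Module.Finite R X → Module.Finite R P) := by
  by_cases h : Module.Finite R X
  · obtain ⟨k, f, hf⟩ := Module.Finite.exists_fin' R X
    exact ⟨ModuleCat.of R (Fin k → R), ModuleCat.ofHom f,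
      (IsProjective.iff_projective _).mp inferInstance, (ModuleCat.epi_iff_surjective _).mpr hf,
      fun _ ↦ inferInstanceAs (Module.Finite R (Fin k → R))⟩
  · exact ⟨Projective.over X, Projective.π X, inferInstance, inferInstance, fun h' ↦ (h h').elim⟩

namespace ModuleCat

/-- A projective module surjecting onto `X`, finitely generated if `X` is. -/
def cover (X : ModuleCat.{u} R) : ModuleCat.{u} R := (exists_projective_cover X).choose

/-- The surjection `cover X ⟶ X`. -/
def coverπ (X : ModuleCat.{u} R) : cover X ⟶ X := (exists_projective_cover X).choose_spec.choose

instance (X : ModuleCat.{u} R) : Projective (cover X) :=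
  (exists_projective_cover X).choose_spec.choose_spec.1

instance (X : ModuleCat.{u} R) : Epi (coverπ X) :=
  (exists_projective_cover X).choose_spec.choose_spec.2.1

instance (X : ModuleCat.{u} R) [h : Module.Finite R X] : Module.Finite R (cover X) :=
  (exists_projective_cover X).choose_spec.choose_spec.2.2 h

instance {X Y : ModuleCat.{u} R} (f : X ⟶ Y) [IsNoetherianRing R] [Module.Finite R X] :
    Module.Finite R (kernel f : ModuleCat R) :=
  Module.Finite.of_injective (kernel.ι f).hom ((ModuleCat.mono_iff_injective _).mp inferInstance)

/-- The map from the cover of the kernel of `f` to the source of `f`. -/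
def coverD {X Y : ModuleCat.{u} R} (f : X ⟶ Y) : cover (kernel f) ⟶ X :=
  coverπ (kernel f) ≫ kernel.ι f

lemma coverD_comp {X Y : ModuleCat.{u} R} (f : X ⟶ Y) : coverD f ≫ f = 0 := by
  simp [coverD]

lemma exact_coverD {X Y : ModuleCat.{u} R} (f : X ⟶ Y) :
    (ShortComplex.mk (coverD f) f (coverD_comp f)).Exact := by
  let α : ShortComplex.mk (coverD f) f (coverD_comp f) ⟶
      ShortComplex.mk (kernel.ι f) f (by simp) :=
    { τ₁ := coverπ _
      τ₂ := 𝟙 _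
      τ₃ := 𝟙 _ }
  rw [ShortComplex.exact_iff_of_epi_of_isIso_of_mono α]
  apply ShortComplex.exact_of_f_is_kernel
  apply kernelIsKernel

lemma exact_of_eq_iso_comp_coverD {W X Y : ModuleCat.{u} R} (f : W ⟶ X) (g : X ⟶ Y)
    (e : W ≅ cover (kernel g)) (h : f = e.hom ≫ coverD g) (w : f ≫ g = 0) :
    (ShortComplex.mk f g w).Exact :=
  (ShortComplex.exact_iff_of_iso (S₁ := ShortComplex.mk f g w)
    (S₂ := ShortComplex.mk _ _ (coverD_comp g))
    (ShortComplex.isoMk e (Iso.refl _) (Iso.refl _) (by simp [h]) (by simp))).mpr (exact_coverD g)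

section

variable (Z : ModuleCat.{u} R)

/-- The chain complex obtained by iteratively covering kernels. -/
def coverComplex : ChainComplex (ModuleCat.{u} R) ℕ :=
  ChainComplex.mk' (cover Z) (cover (kernel (coverπ Z))) (coverD (coverπ Z))
    (fun f => ⟨_, coverD f, coverD_comp f⟩)

lemma coverComplex_d_one_zero : (coverComplex Z).d 1 0 = coverD (coverπ Z) := by
  simp [coverComplex]

/-- The terms of `coverComplex Z` are covers of kernels of the preceding differentials. -/
def coverComplexXIso (n : ℕ) :
    (coverComplex Z).X (n + 2) ≅ cover (kernel ((coverComplex Z).d (n + 1) n)) :=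
  ChainComplex.mk'XIso _ _ _ _ n

lemma coverComplex_d_succ (n : ℕ) :
    (coverComplex Z).d (n + 2) (n + 1) =
      (coverComplexXIso Z n).hom ≫ coverD ((coverComplex Z).d (n + 1) n) :=
  ChainComplex.mk'_d _ _ _ _ n

lemma coverComplex_exactAt_succ (n : ℕ) : (coverComplex Z).ExactAt (n + 1) := by
  rw [HomologicalComplex.exactAt_iff' _ (n + 2) (n + 1) n (by simp) (by simp)]
  exact exact_of_eq_iso_comp_coverD _ _ (coverComplexXIso Z n) (coverComplex_d_succ Z n) _

instance (n : ℕ) : Projective ((coverComplex Z).X n) := by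
  obtain (_ | _ | _ | n) := n <;> exact inferInstanceAs (Projective (cover _))

/-- The augmentation of `coverComplex Z`. -/
def coverComplexπ : (coverComplex Z).X 0 ⟶ Z := coverπ Z

instance : Epi (coverComplexπ Z) := inferInstanceAs (Epi (coverπ Z))

lemma coverComplex_d_comp_π : (coverComplex Z).d 1 0 ≫ coverComplexπ Z = 0 := by
  rw [coverComplex_d_one_zero]
  exact coverD_comp _

lemma coverComplex_exact_zero :
    (ShortComplex.mk _ _ (coverComplex_d_comp_π Z)).Exact := by
  exact exact_of_eq_iso_comp_coverD _ (coverπ Z) (Iso.refl _)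
    ((coverComplex_d_one_zero Z).trans (Category.id_comp _).symm) _

/-- The projective resolution of a module obtained by iteratively covering kernels. -/
def coverResolution : ProjectiveResolution Z where
  complex := coverComplex Z
  π := (ChainComplex.toSingle₀Equiv _ _).symm ⟨coverComplexπ Z, coverComplex_d_comp_π Z⟩
  quasiIso := ⟨fun n => by
    cases n
    · rw [ChainComplex.quasiIsoAt₀_iff, ShortComplex.quasiIso_iff_of_zeros']
      · refine (ShortComplex.exact_and_epi_g_iff_of_iso
          (S₂ := ShortComplex.mk _ _ (coverComplex_d_comp_π Z)) ?_).2
          ⟨coverComplex_exact_zero Z, inferInstanceAs (Epi (coverComplexπ Z))⟩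
        exact ShortComplex.isoMk (Iso.refl _) (Iso.refl _) (Iso.refl _)
          ((Category.id_comp _).trans (Category.comp_id _).symm)
          ((Category.id_comp _).trans (by simp; exact (Category.comp_id _).symm))
      all_goals rfl
    · rw [quasiIsoAt_iff_exactAt']
      · apply coverComplex_exactAt_succ
      · apply ChainComplex.exactAt_succ_single_obj⟩

lemma finite_coverComplex_X [IsNoetherianRing R] [Module.Finite R Z] (n : ℕ) :
    Module.Finite R ((coverComplex Z).X n) := by
  induction n with
  | zero => exact inferInstanceAs (Module.Finite R (cover Z))
  | succ n ih =>
    cases n with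
    | zero => exact inferInstanceAs (Module.Finite R (cover (kernel (coverπ Z))))
    | succ n => exact Module.Finite.equiv (coverComplexXIso Z n).symm.toLinearEquiv

end

end ModuleCat

end FiniteResolution

lemma InDimLT.homology {R : Type} [CommRing R] [IsNoetherianRing R] {n : ℕ}
    (S : ShortComplex (ModuleCat.{0} R)) (h : InDimLT R S.X₂ n) : InDimLT R S.homology n :=
  (h.of_injective S.iCycles.hom ((ModuleCat.mono_iff_injective _).mp inferInstance)).of_surjective
    S.homologyπ.hom ((ModuleCat.epi_iff_surjective _).mp inferInstance)

/-- If `M` is a finitely generated `R`-module over a Noetherian ring and `N` is in dimension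
`< n`, then `Ext_R^i(M, N)` is in dimension `< n` for all `i`. -/
theorem inDimLT_ext (R : Type) [CommRing R] [IsNoetherianRing R] (n : ℕ)
    (M N : Type) [AddCommGroup M] [Module R M] [AddCommGroup N] [Module R N]
    [Module.Finite R M] (hN : InDimLT R N n) (i : ℕ) :
    InDimLT R
      ↥(((Ext R (ModuleCat R) i).obj (Opposite.op (ModuleCat.of R M))).obj (ModuleCat.of R N))
      n := by
  let P := ModuleCat.coverResolution (ModuleCat.of R M)
  have : Module.Finite R (P.complex.X i) := ModuleCat.finite_coverComplex_X _ i
  have h : InDimLT R (P.complex.X i ⟶ ModuleCat.of R N) n :=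
    (hN.linearMap (A := P.complex.X i)).of_injective
      (ModuleCat.homLinearEquiv (S := R)).toLinearMap (LinearEquiv.injective _)
  have h' := InDimLT.homology ((P.complex.linearYonedaObj R (ModuleCat.of R N)).sc i) h
  let e := (P.isoExt (R := R) i (ModuleCat.of R N)).toLinearEquiv
  exact h'.of_injective e.toLinearMap e.injective
end
end
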